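/- arXiv:2001.02946 — 5 statements merged into one kernel-verified Lean document; each statement's English description precedes it below -/
import Mathlib

section
/- If G is a connected cubic graph of order n that is not isomorphic to the complete bipartite graph K_{3,3}, then i(G) ≤ (2/5)n. -/
open SimpleGraph

/-- `S` is an independent dominating set of `G`. -/
def IsIndepDomSet {V : Type*} (G : SimpleGraph V) (S : Set V) : Prop :=
  (∀ v ∉ S, ∃ u ∈ S, G.Adj u v) ∧ ∀ u ∈ S, ∀ v ∈ S, ¬ G.Adj u v

/-- The independent domination number `i(G)`. -/
noncomputable def indepDomNum {V : Type*} (G : SimpleGraph V) : ℕ :=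
  sInf {k | ∃ S : Set V, IsIndepDomSet G S ∧ S.ncard = k}

namespace IndepDom

open Finset

variable {V : Type*} [DecidableEq V]

/-- `N` is the neighbourhood function of a graph of maximum degree at most 3 without a `K_{3,3}`
component. -/
structure IsSubcubic (N : V → Finset V) : Prop where
  symm : ∀ u v, u ∈ N v → v ∈ N u
  irrefl : ∀ v, v ∉ N v
  card_le : ∀ v, #(N v) ≤ 3
  noK33 : ∀ a b c, a ≠ b → a ≠ c → b ≠ c → N a = N b → N a = N c → #(N a) ≠ 3

/-- `v` is adjacent to two vertices of degree 3 with the same neighbourhood. -/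
def Twin (N : V → Finset V) (v : V) : Prop :=
  ∃ a ∈ N v, ∃ b ∈ N v, a ≠ b ∧ N a = N b ∧ #(N a) = 3

open scoped Classical in
/-- Ten times the share of the independent dominating set that `v` pays for. -/
noncomputable def wt (N : V → Finset V) (v : V) : ℕ :=
  if #(N v) = 0 then 10 else if #(N v) = 1 then 6 else
    if #(N v) = 2 then (if Twin N v then 6 else 5) else 4

/-- The weight freed at `v` by the removal of `D`, less the charge for the edges leaving `D`. -/
noncomputable def net (N : V → Finset V) (D : Finset V) (v : V) : ℤ :=
  wt N v - #(N v \ D)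

/-- The closed neighbourhood of `J`. -/
def closedNbhd (N : V → Finset V) (J : Finset V) : Finset V := J ∪ J.biUnion N

/-- The outer boundary of `D`. -/
def outer (N : V → Finset V) (D : Finset V) : Finset V := D.biUnion N \ D

/-- `u` is not isolated but becomes isolated once `D` is removed. -/
def Iso (N : V → Finset V) (D : Finset V) (u : V) : Prop :=
  u ∉ D ∧ N u ≠ ∅ ∧ N u ⊆ D

/-- Removing `D` takes away one neighbour of `u` and leaves it adjacent to a pair of twins. -/
def Dmg (N : V → Finset V) (D : Finset V) (u : V) : Prop :=
  u ∉ D ∧ ∃ d a b, N u = {d, a, b} ∧ d ≠ a ∧ d ≠ b ∧ a ≠ b ∧ d ∈ D ∧ a ∉ D ∧ b ∉ D ∧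
    N a = N b ∧ #(N a) = 3 ∧ Disjoint (N a) D

open scoped Classical in
/-- The vertices isolated by the removal of `D`. -/
noncomputable def iso (N : V → Finset V) (D : Finset V) : Finset V :=
  {u ∈ outer N D | Iso N D u}

open scoped Classical in
/-- The vertices damaged by the removal of `D`. -/
noncomputable def dmg (N : V → Finset V) (D : Finset V) : Finset V :=
  {u ∈ outer N D | Dmg N D u}

/-- No nonempty independent set of non-isolated vertices can be put into the dominating set and
removed, together with its neighbours, within the budget of 10 per vertex. -/
def Bad (N : V → Finset V) : Prop :=
  ∀ J : Finset V, J.Nonempty → (∀ u ∈ J, N u ≠ ∅) → (∀ u ∈ J, ∀ v ∈ J, u ∉ N v) →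
    ∑ d ∈ closedNbhd N J, net N (closedNbhd N J) d <
      10 * #J + 3 * #(iso N (closedNbhd N J)) + #(dmg N (closedNbhd N J))

/-- The graph `N` with the vertices of `D` isolated. -/
def del (N : V → Finset V) (D : Finset V) (u : V) : Finset V :=
  if u ∈ D then ∅ else N u \ D

section

variable {N : V → Finset V} {D : Finset V}

theorem mem_iso {u : V} (h : u ∈ iso N D) :
    u ∉ D ∧ (∃ w, w ∈ N u) ∧ ∀ w ∈ N u, w ∈ D := by
  simp only [iso, mem_filter] at h
  exact ⟨h.2.1, Finset.nonempty_iff_ne_empty.2 h.2.2.1, fun w hw => h.2.2.2 hw⟩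

theorem mem_dmg {u : V} (h : u ∈ dmg N D) :
    u ∉ D ∧ ∃ d a b, N u = {d, a, b} ∧ d ≠ a ∧ d ≠ b ∧ a ≠ b ∧ d ∈ D ∧ a ∉ D ∧ b ∉ D ∧
    N a = N b ∧ #(N a) = 3 ∧ ∀ w ∈ N a, w ∉ D := by
  simp only [dmg, mem_filter] at h
  obtain ⟨h1, d, a, b, h⟩ := h.2
  exact ⟨h1, d, a, b, by simpa only [Finset.disjoint_left] using h⟩

theorem mem_outer (h : IsSubcubic N) {u : V} : u ∈ outer N D ↔ u ∉ D ∧ ∃ d ∈ N u, d ∈ D := by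
  simp only [outer, mem_sdiff, mem_biUnion]
  constructor
  · rintro ⟨⟨d, h1, h2⟩, h3⟩
    exact ⟨h3, d, h.symm _ _ h2, h1⟩
  · rintro ⟨h3, d, h2, h1⟩
    exact ⟨⟨d, h1, h.symm _ _ h2⟩, h3⟩

theorem iso_subset : iso N D ⊆ outer N D := by
  intro u hu
  simp only [iso, mem_filter] at hu
  exact hu.1

theorem dmg_subset : dmg N D ⊆ outer N D := by
  intro u hu
  simp only [dmg, mem_filter] at hu
  exact hu.1

theorem iso_add_dmg_le : #(iso N D) + #(dmg N D) ≤ #(outer N D) := by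
  rw [← card_union_of_disjoint]
  · exact card_le_card (union_subset iso_subset dmg_subset)
  · rw [Finset.disjoint_left]
    intro u h1 h2
    obtain ⟨-, d, a, b, e, -, -, -, -, ha, -⟩ := mem_dmg h2
    exact ha ((mem_iso h1).2.2 a (by simp [e]))

omit [DecidableEq V] in
theorem wt_ge (h : IsSubcubic N) (d : V) : 7 ≤ wt N d + #(N d) := by
  have := h.card_le d
  unfold wt
  split_ifs <;> omega

theorem le_net (h : IsSubcubic N) (d : V) (S : Finset V) (h1 : S ⊆ N d) (h2 : S ⊆ D) :
    7 + (#S : ℤ) ≤ net N D d + 2 * #(N d) := by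
  have := wt_ge h d
  have h3 : #(N d \ D) + #S ≤ #(N d) := by
    have : #(N d \ D) ≤ #(N d \ S) := card_le_card (sdiff_subset_sdiff le_rfl h2)
    rw [card_sdiff_of_subset h1] at this
    have := card_le_card h1
    omega
  unfold net
  omega

def Nb1 (N : V → Finset V) (v a : V) : Prop := N v = {a}
def Nb2 (N : V → Finset V) (v a b : V) : Prop := N v = {a, b} ∧ a ≠ b
def Nb3 (N : V → Finset V) (v a b c : V) : Prop := N v = {a, b, c} ∧ a ≠ b ∧ a ≠ c ∧ b ≠ c

omit [DecidableEq V] in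
theorem Nb1.card {v a : V} (e : Nb1 N v a) : #(N v) = 1 := by rw [e]; rfl
theorem Nb2.card {v a b : V} (e : Nb2 N v a b) : #(N v) = 2 := by rw [e.1, card_pair e.2]
theorem Nb3.card {v a b c : V} (e : Nb3 N v a b c) : #(N v) = 3 := by
  rw [e.1]; exact card_eq_three.2 ⟨a, b, c, e.2.1, e.2.2.1, e.2.2.2, rfl⟩

omit [DecidableEq V] in
theorem Nb1.facts (h : IsSubcubic N) {v a : V} (e : Nb1 N v a) :
    a ∈ N v ∧ v ∈ N a ∧ v ≠ a ∧ ∀ u ∈ N v, u = a := by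
  have := h.symm a v
  have := h.irrefl v
  rw [Nb1] at e
  simp_all

theorem Nb2.facts (h : IsSubcubic N) {v a b : V} (e : Nb2 N v a b) :
    a ∈ N v ∧ b ∈ N v ∧ v ∈ N a ∧ v ∈ N b ∧ v ≠ a ∧ v ≠ b ∧ a ≠ b ∧
    ∀ u ∈ N v, u = a ∨ u = b := by
  have := h.symm a v
  have := h.symm b v
  have := h.irrefl v
  rw [Nb2] at e
  simp_all

theorem Nb3.facts (h : IsSubcubic N) {v a b c : V} (e : Nb3 N v a b c) :
    a ∈ N v ∧ b ∈ N v ∧ c ∈ N v ∧ v ∈ N a ∧ v ∈ N b ∧ v ∈ N c ∧ v ≠ a ∧ v ≠ b ∧ v ≠ c ∧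
    a ≠ b ∧ a ≠ c ∧ b ≠ c ∧ ∀ u ∈ N v, u = a ∨ u = b ∨ u = c := by
  have := h.symm a v
  have := h.symm b v
  have := h.symm c v
  have := h.irrefl v
  rw [Nb3] at e
  simp_all

theorem Nb2.swap {v a b : V} (e : Nb2 N v a b) : Nb2 N v b a :=
  ⟨by rw [e.1, pair_comm], e.2.symm⟩
theorem Nb3.swap {v a b c : V} (e : Nb3 N v a b c) : Nb3 N v b a c :=
  ⟨by rw [e.1, insert_comm], e.2.1.symm, e.2.2.2, e.2.2.1⟩
theorem Nb3.rot {v a b c : V} (e : Nb3 N v a b c) : Nb3 N v b c a :=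
  ⟨by rw [e.1]; ext; simp; tauto, e.2.2.2, e.2.1.symm, e.2.2.1.symm⟩

theorem nb_cases (h : IsSubcubic N) {v a : V} (ha : a ∈ N v) :
    Nb1 N v a ∨ (∃ b, Nb2 N v a b) ∨ ∃ b c, Nb3 N v a b c := by
  have h3 := h.card_le v
  have hp : 0 < #(N v) := card_pos.2 ⟨a, ha⟩
  obtain h1 | h1 | h1 : #(N v) = 1 ∨ #(N v) = 2 ∨ #(N v) = 3 := by omega
  · obtain ⟨b, hb⟩ := card_eq_one.1 h1
    rw [hb, mem_singleton] at ha
    exact .inl (ha ▸ hb)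
  · obtain ⟨b, c, hbc, e⟩ := card_eq_two.1 h1
    have e : Nb2 N v b c := ⟨e, hbc⟩
    rw [e.1] at ha
    simp only [mem_insert, mem_singleton] at ha
    rcases ha with rfl | rfl
    exacts [.inr (.inl ⟨_, e⟩), .inr (.inl ⟨_, e.swap⟩)]
  · obtain ⟨b, c, d, h1, h2, h3, e⟩ := card_eq_three.1 h1
    have e : Nb3 N v b c d := ⟨e, h1, h2, h3⟩
    rw [e.1] at ha
    simp only [mem_insert, mem_singleton] at ha
    rcases ha with rfl | rfl | rfl
    exacts [.inr (.inr ⟨_, _, e⟩), .inr (.inr ⟨_, _, e.rot⟩), .inr (.inr ⟨_, _, e.rot.rot⟩)]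

theorem nb_cases₂ (h : IsSubcubic N) {v a b : V} (ha : a ∈ N v) (hb : b ∈ N v) (hab : a ≠ b) :
    Nb2 N v a b ∨ ∃ c, Nb3 N v a b c := by
  rcases nb_cases h ha with e | ⟨c, e⟩ | ⟨c, d, e⟩
  · grind [e.facts h]
  · have := e.facts h
    obtain rfl : b = c := by grind
    exact .inl e
  · have := e.facts h
    obtain rfl | rfl : b = c ∨ b = d := by grind
    exacts [.inr ⟨_, e⟩, .inr ⟨_, e.rot.rot.swap⟩]

theorem nb_cases₃ (h : IsSubcubic N) {v a b c : V} (ha : a ∈ N v) (hb : b ∈ N v) (hc : c ∈ N v)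
    (hab : a ≠ b) (hac : a ≠ c) (hbc : b ≠ c) : Nb3 N v a b c := by
  rcases nb_cases₂ h ha hb hab with e | ⟨d, e⟩
  · grind [e.facts h]
  · have := e.facts h
    obtain rfl : c = d := by grind
    exact e

theorem mem_iso' (h : IsSubcubic N) {u : V} (hu : u ∈ iso N D) :
    u ∉ D ∧ (∃ w, w ∈ N u ∧ u ∈ N w ∧ w ∈ D) ∧ ∀ w ∈ N u, w ∈ D := by
  obtain ⟨h1, ⟨w, hw⟩, h2⟩ := mem_iso hu
  exact ⟨h1, ⟨w, hw, h.symm _ _ hw, h2 w hw⟩, h2⟩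

theorem mem_dmg' (h : IsSubcubic N) {u : V} (hu : u ∈ dmg N D) :
    u ∉ D ∧ ∃ d a b, Nb3 N u d a b ∧ u ∈ N d ∧ d ∈ D ∧ a ∉ D ∧ b ∉ D ∧
    N a = N b ∧ #(N a) = 3 ∧ ∀ w ∈ N a, w ∉ D := by
  obtain ⟨h1, d, a, b, h2, h3, h4, h5, h6, h7, h8, h9, h10, h11⟩ := mem_dmg hu
  exact ⟨h1, d, a, b, ⟨h2, h3, h4, h5⟩, h.symm _ _ (by simp [h2]), h6, h7, h8, h9, h10, h11⟩

theorem mem_outer' (h : IsSubcubic N) {u : V} (hu : u ∈ outer N D) :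
    u ∉ D ∧ ∃ d ∈ D, u ∈ N d := by
  obtain ⟨h1, d, h2, h3⟩ := (mem_outer h).1 hu
  exact ⟨h1, d, h3, h.symm _ _ h2⟩

omit [DecidableEq V] in
theorem card_le_zero_of {s : Finset V} (hs : ∀ u ∈ s, False) : #s ≤ 0 := by
  rw [eq_empty_of_forall_notMem hs]; simp

omit [DecidableEq V] in
theorem card_le_one_of {s : Finset V} (a : V) (hs : ∀ u ∈ s, u = a) : #s ≤ 1 :=
  (card_le_card (t := {a}) fun u hu => by simpa using hs u hu).trans (by simp)

theorem card_le_two_of {s : Finset V} (a b : V) (hs : ∀ u ∈ s, u = a ∨ u = b) : #s ≤ 2 :=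
  (card_le_card (t := {a, b}) fun u hu => by simpa using hs u hu).trans card_le_two

theorem card_le_three_of {s : Finset V} (a b c : V) (hs : ∀ u ∈ s, u = a ∨ u = b ∨ u = c) :
    #s ≤ 3 :=
  (card_le_card (t := {a, b, c}) fun u hu => by simpa using hs u hu).trans card_le_three

theorem card_le_two_of_mem (h : IsSubcubic N) {s : Finset V} {v w : V} (hv : w ∈ N v)
    (hs : ∀ u ∈ s, u ∈ N v ∧ u ≠ w) : #s ≤ 2 := by
  have h1 := card_le_card (s := s) (t := (N v).erase w) fun u hu => by grind
  rw [card_erase_of_mem hv] at h1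
  have := h.card_le v
  omega

theorem net_pos (h : IsSubcubic N) (d : V) : 0 < net N D d := by
  have := le_net (D := D) h d ∅ (by simp) (by simp)
  have := h.card_le d
  simp at *
  omega

theorem net1 (h : IsSubcubic N) {d w : V} (h1 : w ∈ N d) (h2 : w ∈ D) :
    8 ≤ net N D d + 2 * #(N d) := by
  simpa using le_net (D := D) h d {w} (by simpa) (by simpa)

theorem two_le_net (h : IsSubcubic N) {d : V} (w : V) (h1 : w ∈ N d) (h2 : w ∈ D) :
    2 ≤ net N D d := by
  have := net1 h h1 h2
  have := h.card_le d
  omega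

theorem three_le_net (h : IsSubcubic N) {d : V} (w w' : V) (h1 : w ∈ N d) (h2 : w ∈ D)
    (h1' : w' ∈ N d) (h2' : w' ∈ D) (h0 : w ≠ w') : 3 ≤ net N D d := by
  have := le_net (D := D) h d {w, w'} (by grind) (by grind)
  rw [card_pair h0] at this
  have := h.card_le d
  omega

theorem four_le_net (h : IsSubcubic N) {d : V} (h1 : ∀ w ∈ N d, w ∈ D) : 4 ≤ net N D d := by
  have := le_net (D := D) h d _ subset_rfl h1
  have := h.card_le d
  omega

theorem Nb1.net (h : IsSubcubic N) {d w : V} (e : Nb1 N d w) (hw : w ∈ D) : 6 ≤ net N D d := by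
  have := net1 h (e.facts h).1 hw
  have := e.card
  omega

theorem Nb2.net (h : IsSubcubic N) {d w w' : V} (e : Nb2 N d w w') (hw : w ∈ D) :
    4 ≤ net N D d := by
  have := net1 h (e.facts h).1 hw
  have := e.card
  omega

theorem Nb2.net' (h : IsSubcubic N) {d w w' : V} (e : Nb2 N d w w') (hw : w ∈ D) (hw' : w' ∈ D) :
    5 ≤ IndepDom.net N D d := by
  have := le_net (D := D) h d {w, w'} (by simp [e.1]) (by grind)
  rw [card_pair e.2] at this
  have := e.card
  omega

theorem Nb2.netTwin {d w w' : V} (e : Nb2 N d w w') (hw : w ∈ D) (hw' : w' ∈ D)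
    (e' : N w = N w') (h3 : #(N w) = 3) : 6 ≤ IndepDom.net N D d := by
  have ht : Twin N d := ⟨w, by simp [e.1], w', by simp [e.1], e.2, e', h3⟩
  have : N d ⊆ D := by rw [e.1]; grind
  simp [IndepDom.net, wt, e.card, ht, sdiff_eq_empty_iff_subset.2 this]

theorem Bad.of_finset (hb : Bad N) (h : IsSubcubic N) (J : Finset V) (hJ : J.Nonempty)
    (h0 : ∀ u ∈ J, N u ≠ ∅) (hi : ∀ u ∈ J, ∀ v ∈ J, u ∉ N v) :
    ∃ D : Finset V, (∀ u, u ∈ D ↔ u ∈ J ∨ ∃ v ∈ J, u ∈ N v) ∧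
      ∀ l : List V, l.Nodup → (∀ u ∈ l, u ∈ D) →
        (l.map (net N D)).sum < 10 * #J + 3 * #(iso N D) + #(dmg N D) := by
  refine ⟨closedNbhd N J, by simp [closedNbhd], fun l hl hl' => ?_⟩
  rw [← List.sum_toFinset _ hl]
  exact (sum_le_sum_of_subset_of_nonneg (fun u hu => hl' u (by simpa using hu))
    fun u _ _ => (net_pos h u).le).trans_lt (hb J hJ h0 hi)

theorem Bad.of_vertex (hb : Bad N) (h : IsSubcubic N) (v w : V) (hw : w ∈ N v) :
    ∃ D : Finset V, (∀ u, u ∈ D ↔ u = v ∨ u ∈ N v) ∧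
      ∀ l : List V, l.Nodup → (∀ u ∈ l, u ∈ D) →
        (l.map (net N D)).sum < 10 + 3 * #(iso N D) + #(dmg N D) := by
  simpa using hb.of_finset h {v} (by simp) (by simpa using ne_empty_of_mem hw)
    (by simpa using h.irrefl v)

theorem Bad.of_pair (hb : Bad N) (h : IsSubcubic N) (v v' w w' : V) (hv : v ≠ v')
    (hvv : v ∉ N v') (hw : w ∈ N v) (hw' : w' ∈ N v') :
    ∃ D : Finset V, (∀ u, u ∈ D ↔ (u = v ∨ u = v') ∨ u ∈ N v ∨ u ∈ N v') ∧
      ∀ l : List V, l.Nodup → (∀ u ∈ l, u ∈ D) →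
        (l.map (net N D)).sum < 20 + 3 * #(iso N D) + #(dmg N D) := by
  have := h.symm v' v
  simpa [card_pair hv] using hb.of_finset h {v, v'} (by simp)
    (by simpa using ⟨ne_empty_of_mem hw, ne_empty_of_mem hw'⟩) (by simp [h.irrefl]; tauto)

theorem Bad.nb1 (hb : Bad N) (h : IsSubcubic N) {v a : V} (e : Nb1 N v a) :
    ∃ D : Finset V, (∀ u, u ∈ D ↔ u = v ∨ u = a) ∧
      net N D a < 4 + 3 * #(iso N D) + #(dmg N D) := by
  have f := e.facts h
  obtain ⟨D, hD, hl⟩ := hb.of_vertex h v a f.1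
  have hD : ∀ u, u ∈ D ↔ u = v ∨ u = a := by simpa [show N v = _ from e] using hD
  have := hl [v, a] (by simp; grind) (by simp [hD])
  have := e.net (D := D) h (by simp [hD])
  exact ⟨D, hD, by simp at *; omega⟩

theorem Bad.nb2 (hb : Bad N) (h : IsSubcubic N) {v a b : V} (e : Nb2 N v a b) :
    ∃ D : Finset V, (∀ u, u ∈ D ↔ u = v ∨ u = a ∨ u = b) ∧
      net N D a + net N D b < 5 + 3 * #(iso N D) + #(dmg N D) := by
  have f := e.facts h
  obtain ⟨D, hD, hl⟩ := hb.of_vertex h v a f.1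
  have hD : ∀ u, u ∈ D ↔ u = v ∨ u = a ∨ u = b := by simpa [e.1] using hD
  have := hl [v, a, b] (by simp; grind) (by simp [hD])
  have := e.net' (D := D) h (by simp [hD]) (by simp [hD])
  exact ⟨D, hD, by simp at *; omega⟩

theorem Bad.nb3 (hb : Bad N) (h : IsSubcubic N) {v a b c : V} (e : Nb3 N v a b c) :
    ∃ D : Finset V, (∀ u, u ∈ D ↔ u = v ∨ u = a ∨ u = b ∨ u = c) ∧
      net N D a + net N D b + net N D c < 6 + 3 * #(iso N D) + #(dmg N D) := by
  have f := e.facts h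
  obtain ⟨D, hD, hl⟩ := hb.of_vertex h v a f.1
  have hD : ∀ u, u ∈ D ↔ u = v ∨ u = a ∨ u = b ∨ u = c := by simpa [e.1] using hD
  have := hl [v, a, b, c] (by simp; grind) (by simp [hD])
  have := four_le_net (D := D) (d := v) h (by simp [hD, e.1])
  exact ⟨D, hD, by simp at *; omega⟩

/-- No vertex has two neighbours of degree one. -/
theorem Bad.leaf_unique (hb : Bad N) (h : IsSubcubic N) {v a b : V} (ea : Nb1 N a v)
    (eb : Nb1 N b v) : a = b := by
  by_contra hab
  have fa := ea.facts h
  have fb := eb.facts h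
  have hs := h.symm
  rcases nb_cases₂ h fa.2.1 fb.2.1 hab with e | ⟨c, e⟩
  · have f := e.facts h
    obtain ⟨D, hD, key⟩ := hb.nb2 h e
    have n1 := ea.net (D := D) h (by simp [hD])
    have n2 := eb.net (D := D) h (by simp [hD])
    have ho : #(outer N D) ≤ 0 := card_le_zero_of fun u hu => by
      have := mem_outer' h hu
      grind
    have := iso_add_dmg_le (N := N) (D := D)
    omega
  · have f := e.facts h
    obtain ⟨D, hD, key⟩ := hb.nb3 h e
    have n1 := ea.net (D := D) h (by simp [hD])
    have n2 := eb.net (D := D) h (by simp [hD])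
    have n3 := two_le_net (D := D) h v f.2.2.2.2.2.1 (by simp [hD])
    have ho : #(outer N D) ≤ 2 := card_le_two_of_mem h f.2.2.2.2.2.1 fun u hu => by
      have := mem_outer' h hu
      grind
    have := iso_add_dmg_le (N := N) (D := D)
    omega

def K (N : V → Finset V) (a b x y z : V) : Prop := a ≠ b ∧ Nb3 N a x y z ∧ Nb3 N b x y z

theorem K.symm {a b x y z : V} (k : K N a b x y z) : K N b a x y z := ⟨k.1.symm, k.2.2, k.2.1⟩
theorem K.swap {a b x y z : V} (k : K N a b x y z) : K N a b y x z := ⟨k.1, k.2.1.swap, k.2.2.swap⟩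
theorem K.rot {a b x y z : V} (k : K N a b x y z) : K N a b y z x := ⟨k.1, k.2.1.rot, k.2.2.rot⟩

theorem mem_dmg'' (h : IsSubcubic N) {u : V} (hu : u ∈ dmg N D) :
    u ∉ D ∧ ∃ d a b y z, Nb3 N u d a b ∧ u ∈ N d ∧ d ∈ D ∧ a ∉ D ∧ b ∉ D ∧ K N a b u y z ∧
      y ∉ D ∧ z ∉ D := by
  obtain ⟨h1, d, a, b, e, h2, h3, h4, h5, h6, h7, h8⟩ := mem_dmg' h hu
  refine ⟨h1, d, a, b, ?_⟩
  have f := e.facts h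
  rcases nb_cases h f.2.2.2.2.1 with e' | ⟨y, e'⟩ | ⟨y, z, e'⟩
  · have := e'.card; omega
  · have := e'.card; omega
  · have f' := e'.facts h
    exact ⟨y, z, e, h2, h3, h4, h5, ⟨e.2.2.2, e', by rw [Nb3, ← h6]; exact e'⟩,
      h8 _ f'.2.1, h8 _ f'.2.2.1⟩

theorem Bad.leaf_nbr (hb : Bad N) (h : IsSubcubic N) {l u : V} (e : Nb1 N l u) :
    ∃ b c, Nb3 N u l b c := by
  have f := e.facts h
  rcases nb_cases h f.2.1 with e' | ⟨y, e'⟩ | e'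
  · obtain ⟨D, hD, key⟩ := hb.nb1 h e
    have n1 := e'.net (D := D) h (by simp [hD])
    have f' := e'.facts h
    have ho : #(outer N D) ≤ 0 := card_le_zero_of fun u hu => by
      have := mem_outer' h hu
      grind
    have := iso_add_dmg_le (N := N) (D := D)
    omega
  · have f' := e'.facts h
    obtain ⟨D, hD, key⟩ := hb.nb1 h e
    have n1 := e'.net (D := D) h (by simp [hD])
    have hi : #(iso N D) ≤ 0 := card_le_zero_of fun v hv => by
      have := mem_iso' h hv
      obtain rfl : v = y := by grind
      rcases nb_cases h f'.2.2.2.1 with e2 | ⟨b, e2⟩ | ⟨b, c, e2⟩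
      · have := hb.leaf_unique h e e2
        grind
      all_goals
        have := e2.facts h
        grind
    obtain ⟨v, hv⟩ : (dmg N D).Nonempty := by
      rw [← card_pos]; omega
    obtain ⟨hvD, d, a, b, y', z', hv, hvd, hdD, haD, hbD, k, hy', hz'⟩ := mem_dmg'' h hv
    have fa := k.2.1.facts h
    have fb := k.2.2.facts h
    have fv := hv.facts h
    obtain rfl : v = y := by grind
    obtain rfl : u = d := by grind
    obtain ⟨D', hD', key'⟩ := hb.nb2 h e'
    have n1 := e.net (D := D') h (by simp [hD'])
    have n2 := two_le_net (D := D') h (d := v) u f'.2.2.2.1 (by simp [hD'])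
    have hi' : #(iso N D') ≤ 0 := card_le_zero_of fun w hw => by
      have := mem_iso' h hw
      grind
    have hj : #(dmg N D') ≤ 2 := card_le_two_of a b fun w hw => by
      have := mem_dmg'' h hw
      grind
    omega
  · exact e'

omit [DecidableEq V] in
theorem nb1_of {v a : V} (ha : a ∈ N v) (hv : ∀ u ∈ N v, u = a) : Nb1 N v a := by
  ext u
  grind

theorem nb2_of {v a b : V} (ha : a ∈ N v) (hb : b ∈ N v) (hab : a ≠ b)
    (hv : ∀ u ∈ N v, u = a ∨ u = b) : Nb2 N v a b :=
  ⟨by ext u; grind, hab⟩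

theorem K.not_adj {a b x y z : V} (k : K N a b x y z) (hb : Bad N) (h : IsSubcubic N) :
    y ∉ N x := by
  intro hy
  obtain ⟨hab, ea, eb⟩ := k
  have fa := ea.facts h
  have fb := eb.facts h
  have ex := nb_cases₃ h fa.2.2.2.1 fb.2.2.2.1 hy hab (by grind) (by grind)
  have ey := nb_cases₃ h fa.2.2.2.2.1 fb.2.2.2.2.1 (h.symm _ _ hy) hab (by grind) (by grind)
  have fx := ex.facts h
  have fy := ey.facts h
  obtain ⟨D, hD, key⟩ := hb.nb3 h ex
  have n1 := three_le_net (D := D) (d := a) h x y (by grind) (by grind) (by grind) (by grind)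
    (by grind)
  have n2 := three_le_net (D := D) (d := b) h x y (by grind) (by grind) (by grind) (by grind)
    (by grind)
  have n3 := four_le_net (D := D) (d := y) h (by grind)
  have ho : #(outer N D) ≤ 1 := card_le_one_of z fun u hu => by
    have := mem_outer' h hu
    grind
  have := iso_add_dmg_le (N := N) (D := D)
  omega

theorem K.nb3_of_leaf {a b x y z p l : V} (k : K N a b x y z) (hb : Bad N)
    (h : IsSubcubic N) (ez : Nb3 N z a b p) (hl : Nb1 N l p) {w : V} (hw : w ∈ N p) (hwz : w ≠ z)
    (hwl : w ≠ l) : #(N w) = 3 := by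
  have fa := k.2.1.facts h
  have fb := k.2.2.facts h
  have fz := ez.facts h
  have fl := hl.facts h
  have fp : Nb3 N p l w z := by
    apply nb_cases₃ h fl.2.1 hw fz.2.2.2.2.2.1 (Ne.symm hwl) _ hwz
    grind
  have fp' := fp.facts h
  rcases nb_cases h (v := w) (a := p) (by grind) with ew | ⟨u, ew⟩ | ⟨u, v, ew⟩
  · exact absurd (hb.leaf_unique h ew hl) hwl
  · obtain ⟨D, hD, key⟩ := hb.nb3 h fp
    have fw := ew.facts h
    have n1 := hl.net (D := D) h (by grind)
    have n2 := ew.net (D := D) h (by grind)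
    have n3 := two_le_net (D := D) h (d := z) p (by grind) (by grind)
    have ho : #(outer N D) ≤ 3 := card_le_three_of a b u fun u hu => by
      have := mem_outer' h hu
      grind
    have hi : #(iso N D) ≤ 1 := card_le_one_of u fun u hu => by
      have := mem_iso' h hu
      grind
    have := iso_add_dmg_le (N := N) (D := D)
    omega
  · exact ew.card

theorem K.K33_minus_one {a b x y z v p : V} (k : K N a b x y z) (k' : K N x y a b v)
    (hb : Bad N) (h : IsSubcubic N) (hvz : v ≠ z) (hz : z ∉ N v) (ez : Nb2 N z a b)
    (ev : Nb3 N v x y p) : False := by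
  have fa := k.2.1.facts h
  have fb := k.2.2.facts h
  have fx := k'.2.1.facts h
  have fy := k'.2.2.facts h
  have fz := ez.facts h
  have fv := ev.facts h
  obtain ⟨D, hD, hl⟩ := hb.of_pair h v z x a hvz (fun hv => hz (h.symm _ _ hv)) fv.1 fz.1
  have key := hl [v, z, x, y, a, b, p] (by simp; grind) (by simp; grind)
  simp at key
  have n1 := four_le_net (D := D) (d := v) h (by grind)
  have n2 := ez.net' (D := D) h (by grind) (by grind)
  have n3 := four_le_net (D := D) (d := x) h (by grind)
  have n4 := four_le_net (D := D) (d := y) h (by grind)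
  have n5 := four_le_net (D := D) (d := a) h (by grind)
  have n6 := four_le_net (D := D) (d := b) h (by grind)
  have n7 := two_le_net (D := D) (d := p) h v (by grind) (by grind)
  have ho : #(outer N D) ≤ 2 := card_le_two_of_mem h fv.2.2.2.2.2.1 fun u hu => by
    have := mem_outer' h hu
    grind
  have hi : #(iso N D) ≤ 1 := card_le_one.2 fun u hu w hw => by
    refine hb.leaf_unique (v := p) h (nb1_of ?_ ?_) (nb1_of ?_ ?_)
    · have := mem_iso' h hu
      grind
    · have := mem_iso' h hu
      have := h.symm
      grind
    · have := mem_iso' h hw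
      grind
    · have := mem_iso' h hw
      have := h.symm
      grind
  have := iso_add_dmg_le (N := N) (D := D)
  omega

theorem K.no_common {a b x y z v : V} (k : K N a b x y z) (hb : Bad N) (h : IsSubcubic N)
    (hx : v ∈ N x) (hy : v ∈ N y) (hva : v ≠ a) : v = b := by
  by_contra hvb
  have fa := k.2.1.facts h
  have fb := k.2.2.facts h
  have hab := k.1
  have ex := nb_cases₃ h fa.2.2.2.1 fb.2.2.2.1 hx hab (Ne.symm hva) (Ne.symm hvb)
  have ey := nb_cases₃ h fa.2.2.2.2.1 fb.2.2.2.2.1 hy hab (Ne.symm hva) (Ne.symm hvb)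
  have k' : K N x y a b v := ⟨by grind, ex, ey⟩
  have fx := ex.facts h
  have fy := ey.facts h
  have hzv : z ∉ N v := by
    intro hz
    have ev := nb_cases₃ h fx.2.2.2.2.2.1 fy.2.2.2.2.2.1 hz (by grind) (by grind) (by grind)
    exact h.noK33 a b v hab (Ne.symm hva) (Ne.symm hvb) (by rw [k.2.1.1, k.2.2.1])
      (by rw [k.2.1.1, ev.1]) k.2.1.card
  have hvz : v ≠ z := by
    rintro rfl
    exact k.rot.not_adj hb h hy
  have hvz' : v ∉ N z := fun hv => hzv (h.symm _ _ hv)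
  rcases nb_cases₂ h fa.2.2.2.2.2.1 fb.2.2.2.2.2.1 hab with ez | ⟨q, ez⟩ <;>
    rcases nb_cases₂ h fx.2.2.2.2.2.1 fy.2.2.2.2.2.1 k'.1 with ev | ⟨p, ev⟩
  · have fz := ez.facts h
    have fv := ev.facts h
    obtain ⟨D, hD, hl⟩ := hb.of_pair h v z x a hvz hvz' fv.1 fz.1
    have key := hl [v, z, x, y, a, b] (by simp; grind) (by simp; grind)
    simp at key
    have n1 := ev.net' (D := D) h (by grind) (by grind)
    have n2 := ez.net' (D := D) h (by grind) (by grind)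
    have n3 := four_le_net (D := D) (d := x) h (by grind)
    have n4 := four_le_net (D := D) (d := y) h (by grind)
    have n5 := four_le_net (D := D) (d := a) h (by grind)
    have n6 := four_le_net (D := D) (d := b) h (by grind)
    have ho : #(outer N D) ≤ 0 := card_le_zero_of fun u hu => by
      have := mem_outer' h hu
      grind
    have := iso_add_dmg_le (N := N) (D := D)
    omega
  · exact k.K33_minus_one k' hb h hvz hzv ez ev
  · exact k'.K33_minus_one k hb h hvz.symm hvz' ev ez
  · have fz := ez.facts h
    have fv := ev.facts h
    obtain ⟨D, hD, hl⟩ := hb.of_pair h v z x a hvz hvz' fv.1 fz.1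
    have n1 := four_le_net (D := D) (d := v) h (by grind)
    have n2 := four_le_net (D := D) (d := z) h (by grind)
    have n3 := four_le_net (D := D) (d := x) h (by grind)
    have n4 := four_le_net (D := D) (d := y) h (by grind)
    have n5 := four_le_net (D := D) (d := a) h (by grind)
    have n6 := four_le_net (D := D) (d := b) h (by grind)
    have hod := iso_add_dmg_le (N := N) (D := D)
    by_cases hpq : p = q
    · subst hpq
      have key := hl [v, z, x, y, a, b, p] (by simp; grind) (by simp; grind)
      simp at key
      have n7 := three_le_net (D := D) (d := p) h v z (by grind) (by grind) (by grind) (by grind)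
        hvz
      have ho : #(outer N D) ≤ 1 := by
        rcases nb_cases₂ h (v := p) (a := v) (b := z) (by grind) (by grind) hvz with ep | ⟨w, ep⟩
        · have fp := ep.facts h
          refine card_le_one_of p fun u hu => ?_
          have := mem_outer' h hu
          grind
        · have fp := ep.facts h
          refine card_le_one_of w fun u hu => ?_
          have := mem_outer' h hu
          grind
      omega
    · have key := hl [v, z, x, y, a, b, p, q] (by simp; grind) (by simp; grind)
      simp at key
      by_cases hadj : p ∈ N q
      · have hadj' := h.symm _ _ hadj
        have n7 := three_le_net (D := D) (d := p) h v q (by grind) (by grind) (by grind) (by grind)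
          (by grind)
        have n8 := three_le_net (D := D) (d := q) h z p (by grind) (by grind) (by grind) (by grind)
          (by grind)
        have ho : #(outer N D) ≤ 2 := by
          have hs : outer N D ⊆ (N p \ {v, q}) ∪ (N q \ {z, p}) := fun u hu => by
            have := mem_outer' h hu
            grind
          have h1 : #(N p \ {v, q}) ≤ 1 := by
            rw [card_sdiff_of_subset (by grind), card_pair (by grind)]
            have := h.card_le p
            omega
          have h2 : #(N q \ {z, p}) ≤ 1 := by
            rw [card_sdiff_of_subset (by grind), card_pair (by grind)]
            have := h.card_le q
            omega
          have := card_le_card hs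
          have := card_union_le (N p \ {v, q}) (N q \ {z, p})
          omega
        omega
      · have n7 := two_le_net (D := D) (d := p) h v (by grind) (by grind)
        have n8 := two_le_net (D := D) (d := q) h z (by grind) (by grind)
        have ho : #(outer N D) ≤ 4 := by
          have hs : outer N D ⊆ (N p).erase v ∪ (N q).erase z := fun u hu => by
            have := mem_outer' h hu
            grind
          have h1 : #((N p).erase v) ≤ 2 := by
            rw [card_erase_of_mem (by grind)]
            have := h.card_le p
            omega
          have h2 : #((N q).erase z) ≤ 2 := by
            rw [card_erase_of_mem (by grind)]
            have := h.card_le q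
            omega
          have := card_le_card hs
          have := card_union_le ((N p).erase v) ((N q).erase z)
          omega
        have hw : ∀ w ∈ iso N D, w ≠ v ∧ w ≠ z ∧ (Nb1 N w p ∨ Nb1 N w q ∨ Nb2 N w p q) := by
          intro w hw
          obtain ⟨hw1, hw2, hw3⟩ := mem_iso' h hw
          have hw4 : ∀ u ∈ N w, u = p ∨ u = q := fun u hu => by
            have := h.symm _ _ hu
            have := hw3 u hu
            grind
          refine ⟨by grind, by grind, ?_⟩
          by_cases h1 : p ∈ N w
          · by_cases h2 : q ∈ N w
            · exact .inr (.inr (nb2_of h1 h2 hpq hw4))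
            · exact .inl (nb1_of h1 (by grind))
          · exact .inr (.inl (nb1_of (by grind) (by grind)))
        have hi : #(iso N D) ≤ 2 := by
          by_cases hp : ∃ l, Nb1 N l p
          · obtain ⟨l, hlp⟩ := hp
            by_cases hq : ∃ m, Nb1 N m q
            · obtain ⟨m, hmq⟩ := hq
              refine card_le_two_of l m fun w hwi => ?_
              obtain ⟨hwv, hwz, hw | hw | hw⟩ := hw w hwi
              · exact .inl (hb.leaf_unique h hw hlp)
              · exact .inr (hb.leaf_unique h hw hmq)
              · have := hw.card
                have := hw.facts h
                have := k'.nb3_of_leaf hb h ev hlp (w := w) (by grind) hwv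
                grind
            · refine (card_le_one_of l fun w hwi => ?_).trans (by simp)
              obtain ⟨hwv, hwz, hw | hw | hw⟩ := hw w hwi
              · exact hb.leaf_unique h hw hlp
              · exact absurd ⟨w, hw⟩ hq
              · have := hw.card
                have := hw.facts h
                have := k'.nb3_of_leaf hb h ev hlp (w := w) (by grind) hwv
                grind
          · refine card_le_two_of_mem h (v := q) (w := z) (by grind) fun w hwi => ?_
            obtain ⟨hwv, hwz, hw | hw | hw⟩ := hw w hwi
            · exact absurd ⟨w, hw⟩ hp
            · have := hw.facts h
              grind
            · have := hw.facts h
              grind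
        omega

theorem notMem_dmg (h : IsSubcubic N) {u d e : V} (hd : d ∈ N u) (he : e ∈ N u) (hde : d ≠ e)
    (hdD : d ∈ D) (heD : e ∈ D) : u ∉ dmg N D := by
  intro hu
  obtain ⟨h1, c, p, q, y, z, h2, h3⟩ := mem_dmg'' h hu
  have := h2.facts h
  grind

theorem K.not_all_nb2 {a b x y z : V} (k : K N a b x y z) (hb : Bad N) (h : IsSubcubic N)
    (ey : Nb2 N y a b) (ez : Nb2 N z a b) : False := by
  have fa := k.2.1.facts h
  have fb := k.2.2.facts h
  have hba : b ∉ N a := by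
    have := k.1
    intro hb
    have := fb.2.2.2.2.2.2.2.2.2.2.2.2
    have := h.irrefl b
    have : N a = N b := by rw [k.2.1.1, k.2.2.1]
    grind
  have hab := k.1
  have fy := ey.facts h
  have fz := ez.facts h
  have hN : N a = N b := by rw [k.2.1.1, k.2.2.1]
  obtain ⟨D, hD, hl⟩ := hb.of_pair h b a x x hab.symm hba fb.1 fa.1
  have key := hl [a, b, x, y, z] (by simp; grind) (by simp; grind)
  simp at key
  have n1 := four_le_net (D := D) (d := a) h (by grind)
  have n2 := four_le_net (D := D) (d := b) h (by grind)
  have n3 := ey.netTwin (D := D) (by grind) (by grind) hN k.2.1.card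
  have n4 := ez.netTwin (D := D) (by grind) (by grind) hN k.2.1.card
  have n5 := three_le_net (D := D) (d := x) h a b (by grind) (by grind) (by grind) (by grind) hab
  have hod := iso_add_dmg_le (N := N) (D := D)
  have ho : #(outer N D) ≤ 1 := by
    rcases nb_cases₂ h fa.2.2.2.1 fb.2.2.2.1 hab with ex | ⟨c, ex⟩
    · have fx := ex.facts h
      refine card_le_one_of x fun u hu => ?_
      have := mem_outer' h hu
      grind
    · have fx := ex.facts h
      refine card_le_one_of c fun u hu => ?_
      have := mem_outer' h hu
      grind
  omega

theorem K.not_nb1 {a b x y z x' y' : V} (k : K N a b x y z) (hb : Bad N) (h : IsSubcubic N)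
    (ex : Nb3 N x a b x') (ey : Nb3 N y a b y') (ex' : Nb1 N x' x) : False := by
  have fa := k.2.1.facts h
  have fb := k.2.2.facts h
  have fx := ex.facts h
  have fy := ey.facts h
  have fx' := ex'.facts h
  have hadj := k.not_adj hb h
  have hcom := k.no_common hb h (v := x')
  obtain ⟨D, hD, key⟩ := hb.nb3 h ex
  have n1 := two_le_net (D := D) (d := a) h x (by grind) (by grind)
  have n2 := two_le_net (D := D) (d := b) h x (by grind) (by grind)
  have n3 := ex'.net (D := D) h (by grind)
  have hi : #(iso N D) ≤ 1 := card_le_one_of z fun u hu => by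
    have := mem_iso' h hu
    grind
  have hj : #(dmg N D) ≤ 0 := card_le_zero_of fun u hu => by
    have hu' := mem_dmg'' h hu
    exact notMem_dmg h (u := u) (d := a) (e := b) (by grind) (by grind) k.1 (by grind) (by grind) hu
  omega

theorem K.not_link {a b x y z x' a' b' y' z' y₁ z₁ : V} (k : K N a b x y z)
    (k' : K N a' b' x' y' z') (hb : Bad N) (h : IsSubcubic N)
    (ex : Nb3 N x a b x') (ex' : Nb3 N x' x a' b') (ey : Nb3 N y' a' b' y₁)
    (ez : Nb3 N z' a' b' z₁) : False := by
  have fa := k.2.1.facts h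
  have fb := k.2.2.facts h
  have fa' := k'.2.1.facts h
  have fb' := k'.2.2.facts h
  have fx := ex.facts h
  have fx' := ex'.facts h
  have fy := ey.facts h
  have fz := ez.facts h
  have hadj := k.not_adj hb h
  have hadj' := k.rot.rot.swap.not_adj hb h
  have hcom := k.no_common hb h (v := x')
  have hcom' := k.rot.rot.swap.no_common hb h (v := x')
  have hcom'' := fun v => k.rot.no_common hb h (v := v)
  obtain ⟨D, hD, key⟩ := hb.nb3 h ex'
  have n1 := two_le_net (D := D) (d := x) h x' (by grind) (by grind)
  have n2 := two_le_net (D := D) (d := a') h x' (by grind) (by grind)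
  have n3 := two_le_net (D := D) (d := b') h x' (by grind) (by grind)
  have hy : y ∉ D := by grind
  have hz : z ∉ D := by grind
  have ho : ∀ u ∈ outer N D, u = a ∨ u = b ∨ u = y' ∨ u = z' := fun u hu => by
    have hu' := mem_outer' h hu
    grind
  have hi : #(iso N D) ≤ 0 := card_le_zero_of fun u hu => by
    have hu' := mem_iso' h hu
    obtain rfl | rfl | rfl | rfl := ho u (iso_subset hu)
    all_goals grind
  have hj : #(dmg N D) ≤ 0 := card_le_zero_of fun u hu => by
    obtain ⟨h1, d, p, q, s, t, h2, h3, h4, h5, h6, h7, -⟩ := mem_dmg'' h hu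
    have f2 := h2.facts h
    have f3 := h7.2.1.facts h
    have f4 := h7.2.2.facts h
    obtain rfl | rfl | rfl | rfl := ho u (dmg_subset hu)
    all_goals grind
  omega

theorem K.nbhd_eq {a b x y z : V} (k : K N a b x y z) : N a = N b := by
  rw [k.2.1.1, k.2.2.1]

theorem K.not_link_nb2 {a b x y z x' y' a' b' y₂ z₂ y₃ : V} (k : K N a b x y z)
    (k' : K N a' b' x' y₂ z₂) (hb : Bad N) (h : IsSubcubic N)
    (ex : Nb3 N x a b x') (ey : Nb3 N y a b y') (ez : Nb2 N z a b) (ex' : Nb3 N x' x a' b')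
    (ey₂ : Nb3 N y₂ a' b' y₃) (ez₂ : Nb2 N z₂ a' b') : False := by
  have fa := k.2.1.facts h
  have fb := k.2.2.facts h
  have fa' := k'.2.1.facts h
  have fb' := k'.2.2.facts h
  have fx := ex.facts h
  have fx' := ex'.facts h
  have fy := ey.facts h
  have fz := ez.facts h
  have fy₂ := ey₂.facts h
  have fz₂ := ez₂.facts h
  have hadj := k.not_adj hb h
  have hadj' := k'.not_adj hb h
  have hcom := k.no_common hb h (v := x')
  have hcom' := k'.no_common hb h (v := x)
  have d1 : a' ≠ a ∧ a' ≠ b ∧ a' ≠ x ∧ a' ≠ y ∧ a' ≠ z := by grind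
  have d2 : b' ≠ a ∧ b' ≠ b ∧ b' ≠ x ∧ b' ≠ y ∧ b' ≠ z := by grind
  have d3 : x' ≠ a ∧ x' ≠ b ∧ x' ≠ x ∧ x' ≠ y ∧ x' ≠ z := by grind
  have d4 : y₂ ≠ a ∧ y₂ ≠ b ∧ y₂ ≠ x ∧ y₂ ≠ y ∧ y₂ ≠ z := by grind
  have d5 : z₂ ≠ a ∧ z₂ ≠ b ∧ z₂ ≠ x ∧ z₂ ≠ y ∧ z₂ ≠ z := by grind
  by_cases ht : y' = y₃ ∧ Nb2 N y' y y₂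
  · obtain ⟨rfl, et⟩ := ht
    have ft := et.facts h
    obtain ⟨D, hD, hl⟩ := hb.of_pair h x y' a y (by grind) (by grind) fx.1 ft.1
    have key := hl [x, a, b, x', y', y, y₂] (by simp; grind) (by simp; grind)
    simp at key
    have n1 := four_le_net (D := D) (d := x) h (by grind)
    have n2 := three_le_net (D := D) (d := a) h x y (by grind) (by grind) (by grind) (by grind)
      (by grind)
    have n3 := three_le_net (D := D) (d := b) h x y (by grind) (by grind) (by grind) (by grind)
      (by grind)
    have n4 := two_le_net (D := D) (d := x') h x (by grind) (by grind)
    have n5 := et.net' (D := D) h (by grind) (by grind)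
    have n6 := four_le_net (D := D) (d := y) h (by grind)
    have n7 := two_le_net (D := D) (d := y₂) h y' (by grind) (by grind)
    have ho : ∀ u ∈ outer N D, u = z ∨ u = a' ∨ u = b' := fun u hu => by
      have := mem_outer' h hu
      grind
    have hi : #(iso N D) ≤ 1 := card_le_one_of z fun u hu => by
      have := mem_iso' h hu
      obtain rfl | rfl | rfl := ho u (iso_subset hu)
      · rfl
      all_goals grind
    have hj : #(dmg N D) ≤ 0 := card_le_zero_of fun u hu => by
      obtain rfl | rfl | rfl := ho u (dmg_subset hu)
      · exact notMem_dmg h (d := a) (e := b) (by grind) (by grind) k.1 (by grind) (by grind) hu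
      · exact notMem_dmg h (d := x') (e := y₂) (by grind) (by grind) (by grind) (by grind)
          (by grind) hu
      · exact notMem_dmg h (d := x') (e := y₂) (by grind) (by grind) (by grind) (by grind)
          (by grind) hu
    omega
  · obtain ⟨D, hD, hl⟩ := hb.of_finset h {a, b, a', b'} (by simp)
      (by
        simp only [mem_insert, mem_singleton, ne_eq, ← nonempty_iff_ne_empty]
        rintro u (rfl | rfl | rfl | rfl)
        exacts [⟨x, fa.1⟩, ⟨x, fb.1⟩, ⟨x', fa'.1⟩, ⟨x', fb'.1⟩])
      (by
        have h1 := h.irrefl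
        simp only [mem_insert, mem_singleton]
        rintro u (rfl | rfl | rfl | rfl) v (rfl | rfl | rfl | rfl) huv <;> grind)
    have hD : ∀ u, u ∈ D ↔ u = a ∨ u = b ∨ u = x ∨ u = y ∨ u = z ∨ u = a' ∨ u = b' ∨ u = x' ∨
        u = y₂ ∨ u = z₂ := by
      intro u
      rw [hD]
      simp only [mem_insert, mem_singleton, exists_eq_or_imp, exists_eq_left]
      constructor
      · grind
      · grind
    have key := hl [a, b, x, y, z, a', b', x', y₂, z₂] (by simp; grind) (by simp [hD])
    simp at key
    have n1 := four_le_net (D := D) (d := a) h (by grind)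
    have n2 := four_le_net (D := D) (d := b) h (by grind)
    have n3 := four_le_net (D := D) (d := a') h (by grind)
    have n4 := four_le_net (D := D) (d := b') h (by grind)
    have n5 := four_le_net (D := D) (d := x) h (by grind)
    have n6 := four_le_net (D := D) (d := x') h (by grind)
    have n7 := ez.netTwin (D := D) (by grind) (by grind) k.nbhd_eq k.2.1.card
    have n8 := ez₂.netTwin (D := D) (by grind) (by grind) k'.nbhd_eq k'.2.1.card
    have n9 := three_le_net (D := D) (d := y) h a b (by grind) (by grind) (by grind) (by grind)
      k.1
    have n10 := three_le_net (D := D) (d := y₂) h a' b' (by grind) (by grind) (by grind)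
      (by grind) k'.1
    have ho : ∀ u ∈ outer N D, u = y' ∨ u = y₃ := fun u hu => by
      have := mem_outer' h hu
      grind
    have hod := iso_add_dmg_le (N := N) (D := D)
    have ho' : #(outer N D) ≤ 2 := card_le_two_of y' y₃ ho
    have hi : #(iso N D) ≤ 0 := card_le_zero_of fun u hu => by
      obtain ⟨hu1, -, hu2⟩ := mem_iso' h hu
      have hsu := fun w => h.symm w u
      have hN : ∀ w ∈ N u, w = y ∧ u = y' ∨ w = y₂ ∧ u = y₃ := by grind
      obtain rfl | rfl := ho u (iso_subset hu)
      · by_cases hw : y₂ ∈ N u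
        · exact ht ⟨by grind, nb2_of (by grind) hw (by grind) (by grind)⟩
        · exact k.swap.not_nb1 hb h ey ex (nb1_of (by grind) (by grind))
      · by_cases hw : y ∈ N u
        · have : u = y' := by grind
          subst this
          exact ht ⟨rfl, nb2_of (by grind) (by grind) (by grind) (by grind)⟩
        · exact k'.swap.not_nb1 hb h ey₂ ex'.rot (nb1_of (by grind) (by grind))
    have hc : #({a, b, a', b'} : Finset V) ≤ 4 := card_le_four
    omega

theorem K.not_nb2_of_dmg {a b x y z x' y' a' b' y₂ z₂ : V} (k : K N a b x y z)
    (k' : K N a' b' x' y₂ z₂) (hb : Bad N) (h : IsSubcubic N)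
    (ex : Nb3 N x a b x') (ey : Nb3 N y a b y') (ez : Nb2 N z a b) (ex' : Nb3 N x' x a' b') :
    False := by
  have fa := k'.2.1.facts h
  have fb := k'.2.2.facts h
  rcases nb_cases₂ h fa.2.2.2.2.1 fb.2.2.2.2.1 k'.1 with ey₂ | ⟨y₃, ey₂⟩ <;>
    rcases nb_cases₂ h fa.2.2.2.2.2.1 fb.2.2.2.2.2.1 k'.1 with ez₂ | ⟨z₃, ez₂⟩
  · exact k'.not_all_nb2 hb h ey₂ ez₂
  · exact k.not_link_nb2 k'.swap.rot hb h ex ey ez ex' ez₂ ey₂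
  · exact k.not_link_nb2 k' hb h ex ey ez ex' ey₂ ez₂
  · exact k.not_link k' hb h ex ex' ey₂ ez₂

theorem K.not_nb2 {a b x y z : V} (k : K N a b x y z) (hb : Bad N) (h : IsSubcubic N)
    (ez : Nb2 N z a b) : False := by
  have fa := k.2.1.facts h
  have fb := k.2.2.facts h
  have fz := ez.facts h
  rcases nb_cases₂ h fa.2.2.2.1 fb.2.2.2.1 k.1 with ex | ⟨x', ex⟩
  · exact k.swap.not_all_nb2 hb h ex ez
  rcases nb_cases₂ h fa.2.2.2.2.1 fb.2.2.2.2.1 k.1 with ey | ⟨y', ey⟩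
  · exact k.not_all_nb2 hb h ey ez
  have fx := ex.facts h
  have fy := ey.facts h
  have hadj := k.not_adj hb h
  have hcom := k.no_common hb h (v := x')
  have hba : b ∉ N a := by grind
  obtain ⟨D, hD, hl⟩ := hb.of_pair h b a x x k.1.symm hba fb.1 fa.1
  have key := hl [a, b, x, y, z] (by simp; grind) (by simp; grind)
  simp at key
  have n1 := four_le_net (D := D) (d := a) h (by grind)
  have n2 := four_le_net (D := D) (d := b) h (by grind)
  have n3 := ez.netTwin (D := D) (by grind) (by grind) k.nbhd_eq k.2.1.card
  have n4 := three_le_net (D := D) (d := x) h a b (by grind) (by grind) (by grind) (by grind) k.1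
  have n5 := three_le_net (D := D) (d := y) h a b (by grind) (by grind) (by grind) (by grind) k.1
  have ho : ∀ u ∈ outer N D, u = x' ∨ u = y' := fun u hu => by
    have := mem_outer' h hu
    grind
  have hi : #(iso N D) ≤ 0 := card_le_zero_of fun u hu => by
    obtain ⟨hu1, -, hu2⟩ := mem_iso' h hu
    have hsu := fun w => h.symm w u
    obtain rfl | rfl := ho u (iso_subset hu)
    · exact k.not_nb1 hb h ex ey (nb1_of (by grind) (by grind))
    · exact k.swap.not_nb1 hb h ey ex (nb1_of (by grind) (by grind))
  obtain ⟨u, hu⟩ : (dmg N D).Nonempty := by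
    rw [← card_pos]
    omega
  obtain ⟨hu1, d, p, q, s, t, eu, hu2, hd, -, -, k', -⟩ := mem_dmg'' h hu
  have hdu := h.symm _ _ hu2
  have hsu := h.symm d u
  obtain rfl | rfl := ho u (dmg_subset hu)
  · obtain rfl : d = x := by grind
    exact k.not_nb2_of_dmg k' hb h ex ey ez eu
  · obtain rfl : d = y := by grind
    exact k.swap.not_nb2_of_dmg k' hb h ey ex ez eu

theorem K.exists_nb3 {a b x y z : V} (k : K N a b x y z) (hb : Bad N) (h : IsSubcubic N) :
    ∃ x', Nb3 N x a b x' := by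
  have fa := k.2.1.facts h
  have fb := k.2.2.facts h
  rcases nb_cases₂ h fa.2.2.2.1 fb.2.2.2.1 k.1 with e | e
  · exact (k.rot.not_nb2 hb h e).elim
  · exact e

def KLeaf (N : V → Finset V) (x : V) : Prop := ∃ a b y z, K N a b x y z

theorem KLeaf_of_mem_dmg (h : IsSubcubic N) {u : V} (hu : u ∈ dmg N D) : KLeaf N u := by
  obtain ⟨-, d, p, q, y, z, -, -, -, -, -, k, -⟩ := mem_dmg'' h hu
  exact ⟨p, q, y, z, k⟩

theorem K.hub_unique {a b x y z a' b' y' z' : V} (k : K N a b x y z)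
    (k' : K N a' b' x y' z') (hb : Bad N) (h : IsSubcubic N) :
    a' = a ∧ b' = b ∨ a' = b ∧ b' = a := by
  have fa := k.2.1.facts h
  have fb := k.2.2.facts h
  have fa' := k'.2.1.facts h
  have fb' := k'.2.2.facts h
  obtain ⟨w, ex⟩ := k.exists_nb3 hb h
  have fx := ex.facts h
  have hcom := k.no_common hb h (v := w)
  have hN := k'.nbhd_eq
  have hsw := h.symm y w
  have hab := k.1
  have hab' := k'.1
  grind

theorem K.hub_not_KLeaf {a b x y z : V} (k : K N a b x y z) (hb : Bad N) (h : IsSubcubic N) :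
    ¬ KLeaf N a := by
  rintro ⟨p, q, s, t, k'⟩
  have key : ∀ x y z, K N a b x y z → K N x y a s t → False := by
    intro x y z k k'
    have f1 := k.2.2.facts h
    have f2 := k'.2.1.facts h
    have f3 := k'.2.2.facts h
    have hb' := k.1
    have hs := k.no_common hb h (v := s) f2.2.1 f3.2.1
    have ht := k.no_common hb h (v := t) f2.2.2.1 f3.2.2.1
    grind
  have fp := k'.2.1.facts h
  have fq := k'.2.2.facts h
  have fa := k.2.1.facts h
  have hp := fa.2.2.2.2.2.2.2.2.2.2.2.2 p fp.2.2.2.1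
  have hq := fa.2.2.2.2.2.2.2.2.2.2.2.2 q fq.2.2.2.1
  have hpq := k'.1
  obtain rfl | rfl | rfl := hp <;> obtain rfl | rfl | rfl := hq
  · exact hpq rfl
  · exact key _ _ _ k k'
  · exact key _ _ _ k.swap.rot k'
  · exact key _ _ _ k.swap k'
  · exact hpq rfl
  · exact key _ _ _ k.rot k'
  · exact key _ _ _ k.rot.rot k'
  · exact key _ _ _ k.rot.swap k'
  · exact hpq rfl

theorem K.hub_notMem_dmg {a b x y z : V} (k : K N a b x y z) (hb : Bad N) (h : IsSubcubic N) :
    a ∉ dmg N D := fun ha => k.hub_not_KLeaf hb h (KLeaf_of_mem_dmg h ha)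

theorem K.outer_not_KLeaf {a b x y z x' : V} (k : K N a b x y z) (hb : Bad N)
    (h : IsSubcubic N) (ex : Nb3 N x a b x') : ¬ KLeaf N x' := by
  rintro ⟨a', b', y', z', k'⟩
  have fa' := k'.2.1.facts h
  have fb' := k'.2.2.facts h
  have fx := ex.facts h
  obtain ⟨y₁, ey⟩ := k'.swap.exists_nb3 hb h
  obtain ⟨z₁, ez⟩ := k'.rot.rot.exists_nb3 hb h
  have hx : x ≠ a' ∧ x ≠ b' := by
    have fa := k.2.1.facts h
    have fb := k.2.2.facts h
    have hcom := k.no_common hb h (v := x')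
    have hcom' := k.rot.rot.swap.no_common hb h (v := x')
    have hN := k'.nbhd_eq
    have := k'.1
    constructor
    · rintro rfl
      have := k'.2.2.facts h
      grind
    · rintro rfl
      have := k'.2.1.facts h
      grind
  have ex' := nb_cases₃ h fx.2.2.2.2.2.1 fa'.2.2.2.1 fb'.2.2.2.1 hx.1 hx.2 k'.1
  exact k.not_link k' hb h ex ex' ey ez

/-- The outer neighbour of the leaf `x` differs from those of the other leaves. -/
theorem K.outer_notMem {a b x y z x' : V} (k : K N a b x y z) (hb : Bad N)
    (h : IsSubcubic N) (ex : Nb3 N x a b x') :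
    x' ≠ y ∧ x' ≠ z ∧ x' ∉ N y ∧ x' ∉ N z ∧ x' ∉ N a ∧ x' ∉ N b := by
  have fa := k.2.1.facts h
  have fb := k.2.2.facts h
  have fx := ex.facts h
  have hadj := k.not_adj hb h
  have hadj' := k.rot.rot.swap.not_adj hb h
  have hcom := k.no_common hb h (v := x')
  have hcom' := k.rot.rot.swap.no_common hb h (v := x')
  grind

theorem K.leaf_notMem {a b x y z x' : V} (k : K N a b x y z) (hb : Bad N)
    (h : IsSubcubic N) (ex : Nb3 N x a b x') (hD : ∀ u, u ∈ D ↔ u = x ∨ u = a ∨ u = b ∨ u = x') :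
    y ∉ iso N D ∧ y ∉ dmg N D := by
  have fa := k.2.1.facts h
  have fb := k.2.2.facts h
  have fx := ex.facts h
  obtain ⟨y', ey⟩ := k.swap.exists_nb3 hb h
  have fy := ey.facts h
  have ho := k.outer_notMem hb h ex
  have ho' := k.swap.outer_notMem hb h ey
  constructor
  · intro hu
    have := mem_iso' h hu
    grind
  · exact notMem_dmg h (d := a) (e := b) (by grind) (by grind) k.1 (by grind) (by grind)

theorem K.outer_not_nb2 {a b x y z x' p : V} (k : K N a b x y z) (hb : Bad N)
    (h : IsSubcubic N) (ex : Nb3 N x a b x') (ex' : Nb2 N x' x p) : False := by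
  have fa := k.2.1.facts h
  have fb := k.2.2.facts h
  have fx := ex.facts h
  have fx' := ex'.facts h
  obtain ⟨D, hD, key⟩ := hb.nb3 h ex
  have n1 := two_le_net (D := D) (d := a) h x (by grind) (by grind)
  have n2 := two_le_net (D := D) (d := b) h x (by grind) (by grind)
  have n3 := ex'.net (D := D) h (by grind)
  have ho : ∀ u ∈ outer N D, u = y ∨ u = z ∨ u = p := fun u hu => by
    have := mem_outer' h hu
    grind
  have hy := k.leaf_notMem hb h ex hD
  have hz := k.rot.rot.swap.leaf_notMem hb h ex hD
  have hi : #(iso N D) ≤ 0 := card_le_zero_of fun u hu => by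
    obtain rfl | rfl | rfl := ho u (iso_subset hu)
    · exact hy.1 hu
    · exact hz.1 hu
    · have := mem_iso' h hu
      have hsu := fun w => h.symm w u
      obtain ⟨c, d, e⟩ := hb.leaf_nbr h (nb1_of (N := N) (v := u) (a := x') (by grind) (by grind))
      have := e.card
      have := ex'.card
      omega
  have hj : #(dmg N D) ≤ 1 := card_le_one_of p fun u hu => by
    obtain rfl | rfl | rfl := ho u (dmg_subset hu)
    · exact absurd hu hy.2
    · exact absurd hu hz.2
    · rfl
  omega

theorem K.outer_nb3 {a b x y z x' : V} (k : K N a b x y z) (hb : Bad N)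
    (h : IsSubcubic N) (ex : Nb3 N x a b x') : ∃ p q, Nb3 N x' x p q := by
  have fx := ex.facts h
  rcases nb_cases h fx.2.2.2.2.2.1 with e | ⟨p, e⟩ | e
  · obtain ⟨y', ey⟩ := k.swap.exists_nb3 hb h
    exact (k.not_nb1 hb h ex ey e).elim
  · exact (k.outer_not_nb2 hb h ex e).elim
  · exact e

theorem K.outer_no_leaf {a b x y z x' p q : V} (k : K N a b x y z) (hb : Bad N)
    (h : IsSubcubic N) (ex : Nb3 N x a b x') (ex' : Nb3 N x' x p q) : ¬ Nb1 N q x' := by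
  intro eq
  have fa := k.2.1.facts h
  have fb := k.2.2.facts h
  have fx := ex.facts h
  have fx' := ex'.facts h
  have fq := eq.facts h
  have hs := k.outer_notMem hb h ex
  have hsy := h.symm x' y
  obtain ⟨D, hD, key⟩ := hb.nb3 h ex'
  have n1 := two_le_net (D := D) (d := x) h x' (by grind) (by grind)
  have n3 := eq.net (D := D) h (by grind)
  have hy : y ∉ D := by grind
  have ha : a ∉ iso N D := fun hu => by
    have := mem_iso' h hu
    grind
  have hb' : b ∉ iso N D := fun hu => by
    have := mem_iso' h hu
    grind
  have ha' := k.hub_notMem_dmg (D := D) hb h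
  have hb'' := k.symm.hub_notMem_dmg (D := D) hb h
  have hc : #(iso N D) + #(dmg N D) = #(iso N D ∪ dmg N D) := by
    rw [card_union_of_disjoint]
    rw [Finset.disjoint_left]
    intro u hu hu'
    obtain ⟨-, -, h1⟩ := mem_iso' h hu
    obtain ⟨-, d, s, t, -, -, h2, -, -, h3, -⟩ := mem_dmg'' h hu'
    have := h2.facts h
    grind
  have ho : ∀ u ∈ iso N D ∪ dmg N D, u ∈ N p ∧ u ≠ x' := fun u hu => by
    have hu' : u ∈ outer N D := by
      rcases mem_union.1 hu with hu | hu
      exacts [iso_subset hu, dmg_subset hu]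
    have := mem_outer' h hu'
    grind
  rcases nb_cases h fx'.2.2.2.2.1 with ep | ⟨w, ep⟩ | ⟨w, w', ep⟩
  · have := hb.leaf_unique h ep eq
    grind
  · have fp := ep.facts h
    have n2 := ep.net (D := D) h (by grind)
    have := card_le_one_of w (s := iso N D ∪ dmg N D) fun u hu => by
      have := ho u hu
      grind
    omega
  · have n2 := two_le_net (D := D) (d := p) h x' (by grind) (by grind)
    have := card_le_two_of_mem h fx'.2.2.2.2.1 ho
    have hi : #(iso N D) ≤ 1 := card_le_one.2 fun u hu w hw => by
      have key : ∀ u ∈ iso N D, Nb1 N u p := fun u hu => by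
        have hsu := fun w => h.symm w u
        have h1 := ho u (mem_union_left _ hu)
        have h2 := mem_iso' h hu
        exact nb1_of (by grind) (by grind)
      exact hb.leaf_unique h (key u hu) (key w hw)
    omega

theorem K.all_KLeaf {a b x y z : V} (k : K N a b x y z) : KLeaf N x ∧ KLeaf N y ∧ KLeaf N z :=
  ⟨⟨_, _, _, _, k⟩, ⟨_, _, _, _, k.swap⟩, ⟨_, _, _, _, k.rot.rot⟩⟩

theorem K.nb3_of_not_KLeaf {a b x y z v w : V} (k : K N a b x y z) (h : IsSubcubic N)
    (hx : x ∈ N v) (hw : w ∈ N v) (hw' : ¬ KLeaf N w) : Nb3 N x a b v := by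
  have fa := k.2.1.facts h
  have fb := k.2.2.facts h
  obtain ⟨h1, h2, h3⟩ := k.all_KLeaf
  refine nb_cases₃ h fa.2.2.2.1 fb.2.2.2.1 (h.symm _ _ hx) k.1 ?_ ?_
  · rintro rfl
    obtain rfl | rfl | rfl := fa.2.2.2.2.2.2.2.2.2.2.2.2 w hw <;> contradiction
  · rintro rfl
    obtain rfl | rfl | rfl := fb.2.2.2.2.2.2.2.2.2.2.2.2 w hw <;> contradiction

theorem K.outer_nb3_leaf {a b x y z x' a₂ b₂ p y₂ z₂ : V} (k : K N a b x y z) (hb : Bad N)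
    (h : IsSubcubic N) (ex : Nb3 N x a b x') (k₂ : K N a₂ b₂ p y₂ z₂) (hp : p ∈ N x') :
    Nb3 N p a₂ b₂ x' := by
  have key : ∀ a₂ b₂, K N a₂ b₂ p y₂ z₂ → a₂ ≠ x' := by
    rintro a₂ b₂ k₂ rfl
    have fx := ex.facts h
    have f := k₂.2.1.facts h
    obtain rfl | rfl | rfl := f.2.2.2.2.2.2.2.2.2.2.2.2 x fx.2.2.2.2.2.1
    · have := k.hub_unique k₂ hb h
      grind
    · have := k.hub_unique k₂.swap hb h
      grind
    · have := k.hub_unique k₂.rot.rot hb h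
      grind
  have fa := k₂.2.1.facts h
  have fb := k₂.2.2.facts h
  exact nb_cases₃ h fa.2.2.2.1 fb.2.2.2.1 (h.symm _ _ hp) k₂.1 (key _ _ k₂) (key _ _ k₂.symm)

theorem K.hub_notMem_iso {a b x y z x' p q : V} (k : K N a b x y z) (hb : Bad N)
    (h : IsSubcubic N) (ex : Nb3 N x a b x') (ex' : Nb3 N x' x p q)
    (hD : ∀ u, u ∈ D → u = x' ∨ u = x ∨ u = p ∨ u = q) : a ∉ iso N D := by
  intro hu
  have fa := k.2.1.facts h
  have fx := ex.facts h
  have fx' := ex'.facts h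
  have hs := k.outer_notMem hb h ex
  have hsy := h.symm x' y
  have := mem_iso' h hu
  grind

theorem K.outer_exists_KLeaf {a b x y z x' p q : V} (k : K N a b x y z) (hb : Bad N)
    (h : IsSubcubic N) (ex : Nb3 N x a b x') (ex' : Nb3 N x' x p q) : KLeaf N p ∨ KLeaf N q := by
  by_contra hc
  rw [not_or] at hc
  have fa := k.2.1.facts h
  have fb := k.2.2.facts h
  have fx := ex.facts h
  have fx' := ex'.facts h
  have hs := k.outer_notMem hb h ex
  have hsw := h.symm x'
  obtain ⟨D, hD, key⟩ := hb.nb3 h ex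
  have n1 := two_le_net (D := D) (d := a) h x (by grind) (by grind)
  have n2 := two_le_net (D := D) (d := b) h x (by grind) (by grind)
  have n3 := two_le_net (D := D) (d := x') h x (by grind) (by grind)
  have ho : ∀ u ∈ outer N D, u = y ∨ u = z ∨ u = p ∨ u = q := fun u hu => by
    have := mem_outer' h hu
    grind
  have hy := k.leaf_notMem hb h ex hD
  have hz := k.rot.rot.swap.leaf_notMem hb h ex hD
  have leaf : ∀ p q, Nb3 N x' x p q → p ∉ iso N D := fun p q ex' hu => by
    have hl := k.outer_no_leaf hb h ex ex'.rot.rot.swap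
    have := mem_iso' h hu
    have hsp := fun w => h.symm w p
    have := ex'.facts h
    exact hl (nb1_of (by grind) (by grind))
  have hi : #(iso N D) ≤ 0 := card_le_zero_of fun u hu => by
    obtain rfl | rfl | rfl | rfl := ho u (iso_subset hu)
    · exact hy.1 hu
    · exact hz.1 hu
    · exact leaf _ _ ex' hu
    · exact leaf _ _ ex'.rot.rot.swap hu
  have hj : #(dmg N D) ≤ 0 := card_le_zero_of fun u hu => by
    obtain rfl | rfl | rfl | rfl := ho u (dmg_subset hu)
    · exact absurd hu hy.2
    · exact absurd hu hz.2
    · exact hc.1 (KLeaf_of_mem_dmg h hu)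
    · exact hc.2 (KLeaf_of_mem_dmg h hu)
  omega

theorem K.outer_not_both_KLeaf {a b x y z x' p q : V} (k : K N a b x y z) (hb : Bad N)
    (h : IsSubcubic N) (ex : Nb3 N x a b x') (ex' : Nb3 N x' x p q) (hp : KLeaf N p) :
    ¬ KLeaf N q := by
  rintro ⟨a₃, b₃, y₃, z₃, k₃⟩
  obtain ⟨a₂, b₂, y₂, z₂, k₂⟩ := hp
  have fx' := ex'.facts h
  have ep := k.outer_nb3_leaf hb h ex k₂ (by grind)
  have eq := k.outer_nb3_leaf hb h ex k₃ (by grind)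
  have fx := ex.facts h
  have fp := ep.facts h
  have fq := eq.facts h
  obtain ⟨D, hD, key⟩ := hb.nb3 h ex'
  have n1 := two_le_net (D := D) (d := x) h x' (by grind) (by grind)
  have n2 := two_le_net (D := D) (d := p) h x' (by grind) (by grind)
  have n3 := two_le_net (D := D) (d := q) h x' (by grind) (by grind)
  have ho : ∀ u ∈ outer N D, u = a ∨ u = b ∨ u = a₂ ∨ u = b₂ ∨ u = a₃ ∨ u = b₃ := fun u hu => by
    have := mem_outer' h hu
    grind
  have hi : ∀ {a b x y z p q}, K N a b x y z → Nb3 N x a b x' → Nb3 N x' x p q →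
      (∀ u, u ∈ D → u = x' ∨ u = x ∨ u = p ∨ u = q) →
      a ∉ iso N D ∧ b ∉ iso N D ∧ a ∉ dmg N D ∧ b ∉ dmg N D := fun k ex ex' hD =>
    ⟨k.hub_notMem_iso hb h ex ex' hD, k.symm.hub_notMem_iso hb h ex.swap ex' hD,
      k.hub_notMem_dmg hb h, k.symm.hub_notMem_dmg hb h⟩
  have h1 := hi k ex ex' (by grind)
  have h2 := hi k₂ ep ex'.swap (by grind)
  have h3 := hi k₃ eq ex'.rot.rot (by grind)
  have hi : #(iso N D) ≤ 0 := card_le_zero_of fun u hu => by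
    have := ho u (iso_subset hu)
    grind
  have hj : #(dmg N D) ≤ 0 := card_le_zero_of fun u hu => by
    have := ho u (dmg_subset hu)
    grind
  omega

theorem K.link_nb3 {a b x y z x' a₂ b₂ p y₂ z₂ q : V} (k : K N a b x y z)
    (k₂ : K N a₂ b₂ p y₂ z₂) (hb : Bad N) (h : IsSubcubic N) (ex : Nb3 N x a b x')
    (ex' : Nb3 N x' x p q) : ∃ r s, Nb3 N q x' r s := by
  have fx' := ex'.facts h
  have ep := k.outer_nb3_leaf hb h ex k₂ (by grind)
  have fx := ex.facts h
  have fp := ep.facts h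
  rcases nb_cases h fx'.2.2.2.2.2.1 with e | ⟨r, e⟩ | e
  · exact (k.outer_no_leaf hb h ex ex' e).elim
  · exfalso
    have fq := e.facts h
    obtain ⟨D, hD, key⟩ := hb.nb3 h ex'
    have n1 := two_le_net (D := D) (d := x) h x' (by grind) (by grind)
    have n2 := two_le_net (D := D) (d := p) h x' (by grind) (by grind)
    have n3 := e.net (D := D) h (by grind)
    have ho : ∀ u ∈ outer N D, u = a ∨ u = b ∨ u = a₂ ∨ u = b₂ ∨ u = r := fun u hu => by
      have := mem_outer' h hu
      grind
    have h1 := k.hub_notMem_iso (D := D) hb h ex ex' (by grind)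
    have h2 := k.symm.hub_notMem_iso (D := D) hb h ex.swap ex' (by grind)
    have h3 := k₂.hub_notMem_iso (D := D) hb h ep ex'.swap (by grind)
    have h4 := k₂.symm.hub_notMem_iso (D := D) hb h ep.swap ex'.swap (by grind)
    have h1' := k.hub_notMem_dmg (D := D) hb h
    have h2' := k.symm.hub_notMem_dmg (D := D) hb h
    have h3' := k₂.hub_notMem_dmg (D := D) hb h
    have h4' := k₂.symm.hub_notMem_dmg (D := D) hb h
    have hi : #(iso N D) ≤ 0 := card_le_zero_of fun u hu => by
      obtain rfl | rfl | rfl | rfl | rfl := ho u (iso_subset hu)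
      · exact h1 hu
      · exact h2 hu
      · exact h3 hu
      · exact h4 hu
      · have := mem_iso' h hu
        have hsu := fun w => h.symm w u
        obtain ⟨c, d, e'⟩ := hb.leaf_nbr h
          (nb1_of (N := N) (v := u) (a := q) (by grind) (by grind))
        have := e.card
        have := e'.card
        omega
    have hj : #(dmg N D) ≤ 1 := card_le_one_of r fun u hu => by
      have := ho u (dmg_subset hu)
      grind
    omega
  · exact e

theorem K.link_cases {a b x y z x' a₂ b₂ p y₂ z₂ q r s : V} (k : K N a b x y z)
    (k₂ : K N a₂ b₂ p y₂ z₂) (hb : Bad N) (h : IsSubcubic N) (ex : Nb3 N x a b x')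
    (ex' : Nb3 N x' x p q) (eq : Nb3 N q x' r s) :
    ∃ r s, Nb3 N q x' r s ∧
      (Nb1 N r q ∨ KLeaf N r ∧ r ≠ y ∧ r ≠ z ∧ r ≠ y₂ ∧ r ≠ z₂) := by
  by_contra hc
  have ep := k.outer_nb3_leaf hb h ex k₂ (by grind [ex'.facts h])
  have fx' := ex'.facts h
  have fx := ex.facts h
  have fp := ep.facts h
  have fq := eq.facts h
  obtain ⟨D, hD, key⟩ := hb.nb3 h ex'
  have n1 := two_le_net (D := D) (d := x) h x' (by grind) (by grind)
  have n2 := two_le_net (D := D) (d := p) h x' (by grind) (by grind)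
  have n3 := two_le_net (D := D) (d := q) h x' (by grind) (by grind)
  have ho : ∀ u ∈ outer N D, u = a ∨ u = b ∨ u = a₂ ∨ u = b₂ ∨ u = r ∨ u = s := fun u hu => by
    have := mem_outer' h hu
    grind
  have h1 := k.hub_notMem_iso (D := D) hb h ex ex' (by grind)
  have h2 := k.symm.hub_notMem_iso (D := D) hb h ex.swap ex' (by grind)
  have h3 := k₂.hub_notMem_iso (D := D) hb h ep ex'.swap (by grind)
  have h4 := k₂.symm.hub_notMem_iso (D := D) hb h ep.swap ex'.swap (by grind)
  have h1' := k.hub_notMem_dmg (D := D) hb h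
  have h2' := k.symm.hub_notMem_dmg (D := D) hb h
  have h3' := k₂.hub_notMem_dmg (D := D) hb h
  have h4' := k₂.symm.hub_notMem_dmg (D := D) hb h
  have isoC : ∀ r s, Nb3 N q x' r s → r ∉ iso N D :=
    fun r s eq hu => by
      refine hc ⟨r, s, eq, .inl ?_⟩
      have ha : r ≠ a := fun e => h1 (e ▸ hu)
      have hb' : r ≠ b := fun e => h2 (e ▸ hu)
      have ha' : r ≠ a₂ := fun e => h3 (e ▸ hu)
      have hb'' : r ≠ b₂ := fun e => h4 (e ▸ hu)
      have := eq.facts h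
      have := mem_iso' h hu
      have hsu := fun w => h.symm w r
      exact nb1_of (by grind) (by grind)
  have dmgC : ∀ r s, Nb3 N q x' r s → r ∉ dmg N D := fun r s eq hu => by
    refine hc ⟨r, s, eq, .inr ⟨KLeaf_of_mem_dmg h hu, ?_⟩⟩
    obtain ⟨-, -, a', b', y', z', -, -, -, -, -, k', hy', hz'⟩ := mem_dmg'' h hu
    have hr : r ∉ D := fun hr => (mem_dmg' h hu).1 hr
    have hx : x ∈ D := by grind
    have hp : p ∈ D := by grind
    have gen : ∀ a b x y z, K N a b x y z → r = y → x ∈ D → False := by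
      rintro a b x y z k rfl hx
      have := k.swap.hub_unique k' hb h
      have f := k'.2.1.facts h
      have g1 := k.2.1.facts h
      have g2 := k.2.2.facts h
      grind
    exact ⟨fun e => gen _ _ _ _ _ k e hx, fun e => gen _ _ _ _ _ k.rot.rot.swap e hx,
      fun e => gen _ _ _ _ _ k₂ e hp, fun e => gen _ _ _ _ _ k₂.rot.rot.swap e hp⟩
  have eq' := eq.rot.rot.swap
  have hi : #(iso N D) ≤ 0 := card_le_zero_of fun u hu => by
    have := ho u (iso_subset hu)
    have := isoC _ _ eq
    have := isoC _ _ eq'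
    grind
  have hj : #(dmg N D) ≤ 0 := card_le_zero_of fun u hu => by
    have := ho u (dmg_subset hu)
    have := dmgC _ _ eq
    have := dmgC _ _ eq'
    grind
  omega

theorem K.link_not_nb2 {a b x y z x' a₂ b₂ p y₂ z₂ q r s t : V} (k : K N a b x y z)
    (k₂ : K N a₂ b₂ p y₂ z₂) (hb : Bad N) (h : IsSubcubic N) (ex : Nb3 N x a b x')
    (ex' : Nb3 N x' x p q) (eq : Nb3 N q x' r s) (er : Nb1 N r q) (es : Nb2 N s q t)
    (hq : ¬ KLeaf N q) : False := by
  have ep := k.outer_nb3_leaf hb h ex k₂ (by grind [ex'.facts h])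
  have fx' := ex'.facts h
  have fx := ex.facts h
  have fp := ep.facts h
  have fq := eq.facts h
  have fr := er.facts h
  have fs := es.facts h
  have fa := k.2.1.facts h
  have fa₂ := k₂.2.1.facts h
  obtain ⟨D, hD, key⟩ := hb.nb3 h eq
  have n1 := two_le_net (D := D) (d := x') h q (by grind) (by grind)
  have n2 := er.net (D := D) h (by grind)
  have n3 := es.net (D := D) h (by grind)
  have ho : ∀ u ∈ outer N D, u = x ∨ u = p ∨ u = t := fun u hu => by
    have := mem_outer' h hu
    grind
  have gen : ∀ a b x y z, K N a b x y z → Nb3 N x a b x' → x ∉ iso N D := by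
    intro a b x y z k ex hu
    have f := ex.facts h
    have f1 := k.2.1.facts h
    have ho := k.outer_notMem hb h ex
    have hs := h.symm a q
    obtain ⟨i1, i2, i3⟩ := k.all_KLeaf
    have := mem_iso' h hu
    grind
  have h1 := gen _ _ _ _ _ k ex
  have h2 := gen _ _ _ _ _ k₂ ep
  have hi : #(iso N D) ≤ 1 := card_le_one_of t fun u hu => by
    have := ho u (iso_subset hu)
    grind
  have hj : #(outer N D) ≤ 3 := card_le_three_of _ _ _ ho
  have := iso_add_dmg_le (N := N) (D := D)
  omega

theorem K.link_false {a b x y z x' a₂ b₂ p y₂ z₂ q r s : V} (k : K N a b x y z)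
    (k₂ : K N a₂ b₂ p y₂ z₂) (hb : Bad N) (h : IsSubcubic N) (ex : Nb3 N x a b x')
    (ex' : Nb3 N x' x p q) (eq : Nb3 N q x' r s) (hq : ¬ KLeaf N q)
    (hy : y ≠ r ∧ y ≠ s) (hz : z ≠ r ∧ z ≠ s) (hr : #(N r) ≠ 2) (hs : #(N s) ≠ 2)
    (hc : (¬ Nb1 N r q ∧ ¬ Nb1 N s q) ∨ ¬ KLeaf N r ∧ ¬ KLeaf N s) : False := by
  obtain ⟨y', ey⟩ := k.swap.exists_nb3 hb h
  obtain ⟨z', ez⟩ := k.rot.rot.exists_nb3 hb h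
  have fx' := ex'.facts h
  have ep := k.outer_nb3_leaf hb h ex k₂ fx'.2.1
  have fx := ex.facts h
  have fp := ep.facts h
  have fq := eq.facts h
  have fy := ey.facts h
  have fz := ez.facts h
  have fa := k.2.1.facts h
  have fb := k.2.2.facts h
  have fa₂ := k₂.2.1.facts h
  have fb₂ := k₂.2.2.facts h
  have lk := k.all_KLeaf
  have lk₂ := k₂.all_KLeaf
  have ox := k.outer_notMem hb h ex
  have oy := k.swap.outer_notMem hb h ey
  have oz := k.rot.rot.outer_notMem hb h ez
  have lx' := k.outer_not_KLeaf hb h ex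
  have ly' := k.swap.outer_not_KLeaf hb h ey
  have lz' := k.rot.rot.outer_not_KLeaf hb h ez
  have la := k.hub_not_KLeaf hb h
  have lb := k.symm.hub_not_KLeaf hb h
  have la₂ := k₂.hub_not_KLeaf hb h
  have lb₂ := k₂.symm.hub_not_KLeaf hb h
  have d1 : y' ≠ x' ∧ y' ≠ x ∧ y' ≠ p ∧ y' ≠ q :=
    ⟨fun e => oy.2.2.1 (e ▸ fx.2.2.1), oy.1, fun e => ly' (e ▸ lk₂.1), fun e => by
      have := fq.2.2.2.2.2.2.2.2.2.2.2.2 y (e ▸ fy.2.2.2.2.2.1)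
      grind⟩
  have d2 : ∀ w, x' ∈ N w → w ≠ y ∧ w ≠ a ∧ w ≠ b ∧ w ≠ z := fun w hw =>
    ⟨fun e => ox.2.2.1 (e ▸ hw), fun e => ox.2.2.2.2.1 (e ▸ hw),
      fun e => ox.2.2.2.2.2 (e ▸ hw), fun e => ox.2.2.2.1 (e ▸ hw)⟩
  have d3 := d2 p fp.2.2.1
  have d4 := d2 q fq.1
  have main : ∀ p₂ q₂, Nb3 N y' y p₂ q₂ → ¬ KLeaf N q₂ → False := by
    intro p₂ q₂ ey' hq₂
    have fy' := ey'.facts h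
    have hsw := h.symm y x'
    have hsq := h.symm y' q
    obtain ⟨D, hD, hl⟩ := hb.of_pair h y x' a x (by grind) (by grind) fy.1 fx'.1
    have hD : ∀ u, u ∈ D ↔ u = y ∨ u = a ∨ u = b ∨ u = y' ∨ u = x' ∨ u = x ∨ u = p ∨ u = q := by
      intro u
      rw [hD, ey.1, ex'.1]
      simp only [mem_insert, mem_singleton]
      clear * -
      tauto
    have hnd : [y, a, b, y', x', x, p, q].Nodup := by
      obtain ⟨-, -, -, -, -, -, -, -, -, i1, -⟩ := fa
      obtain ⟨-, -, -, -, -, -, i2, i3, i4, i5, i6, i7, -⟩ := fx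
      obtain ⟨-, -, -, -, -, -, i8, i9, i10, -, i11, i12, -⟩ := fy
      obtain ⟨-, -, -, -, -, -, i13, i14, i15, i16, i17, i18, -⟩ := fx'
      clear * - i1 i2 i3 i4 i5 i6 i7 i8 i9 i10 i11 i12 i13 i14 i15 i16 i17 i18 d1 d3 d4 ox
      simp only [List.nodup_cons, List.mem_cons, List.not_mem_nil, not_or]
      grind
    have key := hl [y, a, b, y', x', x, p, q] hnd (by simp; grind)
    simp at key
    have n1 := four_le_net (D := D) (d := y) h (by grind)
    have n2 := three_le_net (D := D) (d := a) h x y (by grind) (by grind) (by grind) (by grind)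
      (by grind)
    have n3 := three_le_net (D := D) (d := b) h x y (by grind) (by grind) (by grind) (by grind)
      (by grind)
    have n4 := two_le_net (D := D) (d := y') h y (by grind) (by grind)
    have n5 := four_le_net (D := D) (d := x') h (by grind)
    have n6 := four_le_net (D := D) (d := x) h (by grind)
    have n7 := two_le_net (D := D) (d := p) h x' (by grind) (by grind)
    have n8 := two_le_net (D := D) (d := q) h x' (by grind) (by grind)
    have ho : ∀ u ∈ outer N D,
        u = z ∨ u = p₂ ∨ u = q₂ ∨ u = a₂ ∨ u = b₂ ∨ u = r ∨ u = s := fun u hu => by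
      obtain ⟨hu', d, hd, hd'⟩ := mem_outer' h hu
      have hn := mt (hD u).2 hu'
      clear hl key
      rcases (hD d).1 hd with e | e | e | e | e | e | e | e <;> rw [e] at hd'
      · have := fy.2.2.2.2.2.2.2.2.2.2.2.2 u hd'
        clear * - this hn
        tauto
      · have := fa.2.2.2.2.2.2.2.2.2.2.2.2 u hd'
        clear * - this hn
        tauto
      · have := fb.2.2.2.2.2.2.2.2.2.2.2.2 u hd'
        clear * - this hn
        tauto
      · have := fy'.2.2.2.2.2.2.2.2.2.2.2.2 u hd'
        clear * - this hn
        tauto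
      · have := fx'.2.2.2.2.2.2.2.2.2.2.2.2 u hd'
        clear * - this hn
        tauto
      · have := fx.2.2.2.2.2.2.2.2.2.2.2.2 u hd'
        clear * - this hn
        tauto
      · have := fp.2.2.2.2.2.2.2.2.2.2.2.2 u hd'
        clear * - this hn
        tauto
      · have := fq.2.2.2.2.2.2.2.2.2.2.2.2 u hd'
        clear * - this hn
        tauto
    have zi : z ∉ iso N D := fun hu => by
      obtain rfl | rfl | rfl | rfl | rfl | rfl | rfl | rfl :=
        (hD z').1 ((mem_iso' h hu).2.2 _ fz.2.2.1)
      · exact oz.2.1 rfl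
      · exact fz.2.2.2.2.2.2.2.2.2.2.1 rfl
      · exact fz.2.2.2.2.2.2.2.2.2.2.2.1 rfl
      · exact oz.2.2.2.1 fy.2.2.1
      · exact oz.2.2.1 fx.2.2.1
      · exact oz.1 rfl
      · exact lz' lk₂.1
      · rcases fq.2.2.2.2.2.2.2.2.2.2.2.2 z fz.2.2.2.2.2.1 with e | e | e
        exacts [ox.2.1 e.symm, hz.1 e, hz.2 e]
    have zd : z ∉ dmg N D :=
      notMem_dmg h (d := a) (e := b) (by grind) (by grind) k.1 (by grind) (by grind)
    have ad := k₂.hub_notMem_dmg (D := D) hb h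
    have bd := k₂.symm.hub_notMem_dmg (D := D) hb h
    have hy₂ : y₂ ∉ D := fun hu => by
      obtain rfl | rfl | rfl | rfl | rfl | rfl | rfl | rfl := (hD _).1 hu
      · have := k.swap.hub_unique k₂.swap hb h
        grind
      · exact la lk₂.2.1
      · exact lb lk₂.2.1
      · exact ly' lk₂.2.1
      · exact lx' lk₂.2.1
      · have := k.hub_unique k₂.swap hb h
        grind
      · exact fa₂.2.2.2.2.2.2.2.2.2.1 rfl
      · exact hq lk₂.2.1
    have ai : a₂ ∉ iso N D := fun hu => hy₂ ((mem_iso' h hu).2.2 _ fa₂.2.1)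
    have bi : b₂ ∉ iso N D := fun hu => hy₂ ((mem_iso' h hu).2.2 _ fb₂.2.1)
    have leaf : ∀ u ∈ iso N D, Nb1 N u q ∧ (u = r ∨ u = s) := by
      intro u hu
      have m := mem_iso' h hu
      have hsu := fun w => h.symm w u
      have hn : u ≠ z ∧ u ≠ a₂ ∧ u ≠ b₂ := by grind
      have hm : ∀ w ∈ N u, w = y' ∨ w = q := fun w hw => by
        have hn' := mt (hD u).2 m.1
        have hw' := hsu w hw
        rcases (hD w).1 (m.2.2 w hw) with e | e | e | e | e | e | e | e <;> rw [e] at hw'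
        · have := fy.2.2.2.2.2.2.2.2.2.2.2.2 u hw'
          clear * - this hn'
          tauto
        · have := fa.2.2.2.2.2.2.2.2.2.2.2.2 u hw'
          clear * - this hn' hn
          tauto
        · have := fb.2.2.2.2.2.2.2.2.2.2.2.2 u hw'
          clear * - this hn' hn
          tauto
        · exact .inl e
        · have := fx'.2.2.2.2.2.2.2.2.2.2.2.2 u hw'
          clear * - this hn'
          tauto
        · have := fx.2.2.2.2.2.2.2.2.2.2.2.2 u hw'
          clear * - this hn'
          tauto
        · have := fp.2.2.2.2.2.2.2.2.2.2.2.2 u hw'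
          clear * - this hn' hn
          tauto
        · exact .inr e
      by_cases h1 : y' ∈ N u
      · exfalso
        by_cases h2 : q ∈ N u
        · have e2 := nb2_of h1 h2 d1.2.2.2 hm
          have := e2.card
          have : u = r ∨ u = s := by grind
          grind
        · have e1 := nb1_of (N := N) h1 (by grind)
          have : u = p₂ ∨ u = q₂ := by grind
          rcases this with rfl | rfl
          · exact k.swap.outer_no_leaf hb h ey ey'.rot.rot.swap e1
          · exact k.swap.outer_no_leaf hb h ey ey' e1
      · have h2 : q ∈ N u := by grind
        exact ⟨nb1_of h2 (by grind), by grind⟩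
    have hi : #(iso N D) ≤ 1 := card_le_one.2 fun u hu w hw =>
      hb.leaf_unique h (leaf u hu).1 (leaf w hw).1
    have hj : ∀ u ∈ dmg N D, u = p₂ ∨ u = r ∨ u = s := fun u hu => by
      have h1 := KLeaf_of_mem_dmg h hu
      have := ho u (dmg_subset hu)
      grind
    rcases hc with hc | hc
    · have : #(iso N D) ≤ 0 := card_le_zero_of fun u hu => by
        obtain ⟨h1, rfl | rfl⟩ := leaf u hu
        exacts [hc.1 h1, hc.2 h1]
      have := card_le_three_of _ _ _ hj
      omega
    · have : #(dmg N D) ≤ 1 := card_le_one_of p₂ fun u hu => by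
        have h1 := KLeaf_of_mem_dmg h hu
        have := hj u hu
        grind
      omega
  obtain ⟨p₂, q₂, ey'⟩ := k.swap.outer_nb3 hb h ey
  by_cases h1 : KLeaf N q₂
  · exact main q₂ p₂ ey'.rot.rot.swap
      fun h2 => k.swap.outer_not_both_KLeaf hb h ey ey' h2 h1
  · exact main p₂ q₂ ey' h1

theorem Bad.not_K (hb : Bad N) (h : IsSubcubic N) (a b x y z : V) : ¬ K N a b x y z := by
  intro k
  obtain ⟨x', ex⟩ := k.exists_nb3 hb h
  have main : ∀ p q, Nb3 N x' x p q → KLeaf N p → False := by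
    intro p q ex' hp
    have hq := k.outer_not_both_KLeaf hb h ex ex' hp
    obtain ⟨a₂, b₂, y₂, z₂, k₂⟩ := hp
    obtain ⟨r, s, eq⟩ := k.link_nb3 k₂ hb h ex ex'
    obtain ⟨r, s, eq, hr⟩ := k.link_cases k₂ hb h ex ex' eq
    have fq := eq.facts h
    have hx' := k.outer_not_KLeaf hb h ex
    have lk := k.all_KLeaf
    rcases hr with er | ⟨hr, h1, h2, h3, h4⟩
    · have fr := er.facts h
      have hs : ¬ KLeaf N s := by
        rintro ⟨a₃, b₃, y₃, z₃, k₃⟩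
        exact k₃.outer_no_leaf hb h (k₃.nb3_of_not_KLeaf h fq.2.2.1 fq.1 hx') eq.rot.rot er
      have hr : ¬ KLeaf N r := by
        rintro ⟨a₃, b₃, y₃, z₃, k₃⟩
        have := (k₃.nb3_of_not_KLeaf h fq.2.1 fq.1 hx').card
        have := er.card
        omega
      have hr2 := er.card
      refine k.link_false k₂ hb h ex ex' eq hq ?_ ?_ (by omega) ?_ (.inr ⟨hr, hs⟩)
      · exact ⟨fun e => hr (e ▸ lk.2.1), fun e => hs (e ▸ lk.2.1)⟩
      · exact ⟨fun e => hr (e ▸ lk.2.2), fun e => hs (e ▸ lk.2.2)⟩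
      · intro hs2
        rcases nb_cases h fq.2.2.2.2.2.1 with e | ⟨t, e⟩ | ⟨t, t', e⟩
        · have := e.card
          omega
        · exact k.link_not_nb2 k₂ hb h ex ex' eq er e hq
        · have := e.card
          omega
    · obtain ⟨a₃, b₃, y₃, z₃, k₃⟩ := hr
      have er := k₃.nb3_of_not_KLeaf h fq.2.1 fq.1 hx'
      have hs := (k₃.outer_exists_KLeaf hb h er eq.swap).resolve_left hx'
      obtain ⟨a₄, b₄, y₄, z₄, k₄⟩ := hs
      have es := k₄.nb3_of_not_KLeaf h fq.2.2.1 fq.1 hx'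
      have cr := er.card
      have cs := es.card
      have fin : ¬ Nb1 N r q ∧ ¬ Nb1 N s q :=
        ⟨fun e => by have := e.card; omega, fun e => by have := e.card; omega⟩
      have ep := k.outer_nb3_leaf hb h ex k₂ (ex'.facts h).2.1
      by_cases hs : y ≠ s ∧ z ≠ s
      · exact k.link_false k₂ hb h ex ex' eq hq ⟨h1.symm, hs.1⟩ ⟨h2.symm, hs.2⟩ (by omega)
          (by omega) (.inl fin)
      by_cases hs' : y₂ ≠ s ∧ z₂ ≠ s
      · exact k₂.link_false k hb h ep ex'.swap eq hq ⟨h3.symm, hs'.1⟩ ⟨h4.symm, hs'.2⟩ (by omega)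
          (by omega) (.inl fin)
      have key : ∀ y z y₂ z₂, K N a b x y z → K N a₂ b₂ p y₂ z₂ → y = s → y₂ = s → False := by
        rintro y z y₂ z₂ k k₂ rfl rfl
        have hu := k.swap.hub_unique k₂.swap hb h
        have ho := k.outer_notMem hb h ex
        have fp := ep.facts h
        have fa := k.2.1.facts h
        have fb := k.2.2.facts h
        have fx := ex'.facts h
        have hpa : p ∈ N a := by grind
        rcases fa.2.2.2.2.2.2.2.2.2.2.2.2 p hpa with rfl | rfl | rfl
        · exact fx.2.2.2.2.2.2.2.2.2.1 rfl
        · exact ho.2.2.1 fp.2.2.1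
        · exact ho.2.2.2.1 fp.2.2.1
      have hs : y = s ∨ z = s := by tauto
      have hs' : y₂ = s ∨ z₂ = s := by tauto
      rcases hs with hs | hs <;> rcases hs' with hs' | hs'
      · exact key _ _ _ _ k k₂ hs hs'
      · exact key _ _ _ _ k k₂.rot.rot.swap hs hs'
      · exact key _ _ _ _ k.rot.rot.swap k₂ hs hs'
      · exact key _ _ _ _ k.rot.rot.swap k₂.rot.rot.swap hs hs'
  obtain ⟨p, q, ex'⟩ := k.outer_nb3 hb h ex
  rcases k.outer_exists_KLeaf hb h ex ex' with hp | hq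
  · exact main _ _ ex' hp
  · exact main _ _ ex'.rot.rot.swap hq

theorem Bad.dmg_eq_empty (hb : Bad N) (h : IsSubcubic N) : dmg N D = ∅ := by
  refine eq_empty_of_forall_notMem fun u hu => ?_
  obtain ⟨a, b, y, z, k⟩ := KLeaf_of_mem_dmg h hu
  exact hb.not_K h _ _ _ _ _ k

theorem Bad.twin_ne (hb : Bad N) (h : IsSubcubic N) {a b : V} (hab : a ≠ b) {x y z : V}
    (ea : Nb3 N a x y z) : ¬ Nb3 N b x y z := fun eb => hb.not_K h _ _ _ _ _ ⟨hab, ea, eb⟩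

theorem Bad.leaf_next_aux (hb : Bad N) (h : IsSubcubic N) {l u b c w : V} (el : Nb1 N l u)
    (e : Nb3 N u l b c) (eb : Nb2 N b u w) : False := by
  have fl := el.facts h
  have f := e.facts h
  have fb := eb.facts h
  obtain ⟨D, hD, key⟩ := hb.nb3 h e
  rw [hb.dmg_eq_empty h] at key
  have n1 := el.net (D := D) h (by grind)
  have n2 := eb.net (D := D) h (by grind)
  have n3 := two_le_net (D := D) (d := c) h u (by grind) (by grind)
  have hi : #(iso N D) ≤ 2 := card_le_two_of_mem h f.2.2.2.2.2.1 fun v hv => by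
    have := mem_outer' h (iso_subset hv)
    have m := mem_iso' h hv
    have hs := fun w => h.symm w v
    refine ⟨?_, by grind⟩
    by_contra hc
    obtain rfl : v = w := by grind
    obtain ⟨p, q, e'⟩ := hb.leaf_nbr h (nb1_of (N := N) fb.2.2.2.1 (by grind))
    have := e'.card
    have := eb.card
    omega
  simp at key
  omega

/-- If `u` has a neighbour of degree one, so has every other neighbour of `u`. -/
theorem Bad.leaf_next (hb : Bad N) (h : IsSubcubic N) {l u b c : V} (el : Nb1 N l u)
    (e : Nb3 N u l b c) : ∃ m, Nb1 N m c := by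
  by_contra hc
  have fl := el.facts h
  have f := e.facts h
  rcases nb_cases h f.2.2.2.2.1 with eb | ⟨w, eb⟩ | ⟨b₁, b₂, eb⟩
  · exact absurd (hb.leaf_unique h el eb) f.2.2.2.2.2.2.2.2.2.1
  · exact hb.leaf_next_aux h el e eb
  rcases nb_cases h f.2.2.2.2.2.1 with ec | ⟨w, ec⟩ | ⟨c₁, c₂, ec⟩
  · exact absurd (hb.leaf_unique h el ec) f.2.2.2.2.2.2.2.2.2.2.1
  · exact hb.leaf_next_aux h el e.rot.rot.swap ec
  have fb := eb.facts h
  have fc := ec.facts h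
  obtain ⟨D, hD, key⟩ := hb.nb3 h e
  rw [hb.dmg_eq_empty h] at key
  simp only [card_empty] at key
  have n1 := el.net (D := D) h (by grind)
  by_cases hbc : b ∈ N c
  · have n2 := three_le_net (D := D) (d := b) h u c (by grind) (by grind) (by grind [h.symm b c])
      (by grind) (by grind)
    have n3 := three_le_net (D := D) (d := c) h u b (by grind) (by grind) (by grind)
      (by grind) (by grind)
    have hbc' := h.symm b c hbc
    obtain ⟨d, eb'⟩ := (nb_cases₂ h fb.1 hbc' (by grind)).resolve_left fun e => by
      have := e.card
      have := eb.card
      omega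
    obtain ⟨d', ec'⟩ := (nb_cases₂ h fc.1 hbc (by grind)).resolve_left fun e => by
      have := e.card
      have := ec.card
      omega
    have fb' := eb'.facts h
    have fc' := ec'.facts h
    have hi : #(iso N D) ≤ 2 := card_le_two_of d d' fun v hv => by
      have := mem_outer' h (iso_subset hv)
      grind
    omega
  · have n2 := two_le_net (D := D) (d := b) h u (by grind) (by grind)
    have n3 := two_le_net (D := D) (d := c) h u (by grind) (by grind)
    have hbc' : c ∉ N b := fun hh => hbc (h.symm c b hh)
    have hc' : ∀ v ∈ iso N D, (v = b₁ ∨ v = b₂) ∧ (Nb1 N v b ∨ Nb2 N v b c) := fun v hv => by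
      have m := mem_iso' h hv
      have hs := fun w => h.symm w v
      have hm : ∀ w ∈ N v, w = b ∨ w = c := by grind
      have hbv : b ∈ N v := by
        by_contra hbv
        exact hc ⟨v, nb1_of (by grind) (by grind)⟩
      refine ⟨by grind, ?_⟩
      by_cases hcv : c ∈ N v
      · exact .inr (nb2_of hbv hcv (by grind) hm)
      · exact .inl (nb1_of hbv (by grind))
    have key2 : ∀ b₁ b₂, Nb3 N b u b₁ b₂ → Nb1 N b₁ b → ¬ Nb2 N b₂ b c := by
      intro b₁ b₂ eb e₁ e₂
      have f1 := e₁.facts h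
      have f2 := e₂.facts h
      have fb := eb.facts h
      obtain ⟨D, hD, key⟩ := hb.nb3 h eb
      rw [hb.dmg_eq_empty h] at key
      simp only [card_empty] at key
      have n1 := two_le_net (D := D) (d := u) h b (by grind) (by grind)
      have n2 := e₁.net (D := D) h (by grind)
      have n3 := e₂.net (D := D) h (by grind)
      have hi : #(iso N D) ≤ 2 := card_le_two_of l c fun v hv => by
        have := mem_outer' h (iso_subset hv)
        grind
      omega
    have hi : 1 < #(iso N D) := by omega
    obtain ⟨v, hv, v', hv', hne⟩ := one_lt_card.1 hi
    have key3 : (Nb1 N b₁ b ∨ Nb2 N b₁ b c) ∧ (Nb1 N b₂ b ∨ Nb2 N b₂ b c) := by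
      obtain ⟨g1, g2⟩ := hc' v hv
      obtain ⟨g3, g4⟩ := hc' v' hv'
      rcases g1 with rfl | rfl <;> rcases g3 with rfl | rfl
      exacts [absurd rfl hne, ⟨g2, g4⟩, ⟨g4, g2⟩, absurd rfl hne]
    obtain ⟨e1 | e1, e2 | e2⟩ := key3
    · exact fb.2.2.2.2.2.2.2.2.2.2.2.1 (hb.leaf_unique h e1 e2)
    · exact key2 _ _ eb e1 e2
    · exact key2 _ _ eb.rot.rot.swap e2 e1
    · have f1 := e1.facts h
      have f2 := e2.facts h
      exact hb.twin_ne h (by grind) eb (nb_cases₃ h fc.1 f1.2.2.2.1 f2.2.2.2.1 (by grind)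
        (by grind) (by grind))

theorem Bad.not_nb1 [Fintype V] (hb : Bad N) (h : IsSubcubic N) (l u : V) : ¬ Nb1 N l u := by
  intro el
  set L : Finset V := {l | #(N l) = 1} with hL
  have hleaf : ∀ l ∈ L, ∃ u, Nb1 N l u := fun l hl => by
    obtain ⟨u, e⟩ := card_eq_one.1 ((mem_filter.1 hl).2)
    exact ⟨u, e⟩
  have hmem : ∀ {l u}, Nb1 N l u → l ∈ L := fun e => by simp [hL, e.card]
  have hmem' : ∀ {l u}, Nb1 N l u → u ∈ L.biUnion N := fun e =>
    mem_biUnion.2 ⟨_, hmem e, (e.facts h).1⟩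
  have hL' : ∀ u ∈ L.biUnion N, ∃ l, Nb1 N l u := fun u hu => by
    obtain ⟨l, hl, hlu⟩ := mem_biUnion.1 hu
    obtain ⟨w, e⟩ := hleaf l hl
    obtain rfl := (e.facts h).2.2.2 u hlu
    exact ⟨l, e⟩
  have hdis : ∀ u ∈ L, u ∉ L.biUnion N := fun u hu hu' => by
    obtain ⟨l, e⟩ := hL' u hu'
    obtain ⟨p, q, e'⟩ := hb.leaf_nbr h e
    have := e'.card
    have := (mem_filter.1 hu).2
    omega
  have hclosed : ∀ u ∈ L.biUnion N, N u ⊆ closedNbhd N L := fun u hu w hw => by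
    obtain ⟨l, e⟩ := hL' u hu
    obtain ⟨p, q, e'⟩ := hb.leaf_nbr h e
    obtain ⟨m, em⟩ := hb.leaf_next h e e'
    obtain ⟨m', em'⟩ := hb.leaf_next h e e'.rot.rot.swap
    rw [closedNbhd, mem_union]
    obtain rfl | rfl | rfl := (e'.facts h).2.2.2.2.2.2.2.2.2.2.2.2 w hw
    exacts [.inl (hmem e), .inr (hmem' em'), .inr (hmem' em)]
  have hb' := hb L ⟨l, hmem el⟩ (fun u hu e => by simp [hL, e] at hu)
    fun u hu v hv huv => hdis u hu (mem_biUnion.2 ⟨v, hv, huv⟩)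
  have ho : #(outer N (closedNbhd N L)) ≤ 0 := card_le_zero_of fun u hu => by
    obtain ⟨hu, d, hd, hud⟩ := mem_outer' h hu
    rw [closedNbhd, mem_union] at hd
    rcases hd with hd | hd
    · exact hu (mem_union_right _ (mem_biUnion.2 ⟨d, hd, hud⟩))
    · exact hu (hclosed d hd hud)
  have hio := iso_add_dmg_le (N := N) (D := closedNbhd N L)
  have hpd : (L : Set V).PairwiseDisjoint N := fun l hl m hm hlm => by
    rw [Function.onFun, Finset.disjoint_left]
    intro u hu hu'
    obtain ⟨w, e⟩ := hleaf l hl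
    obtain ⟨w', e'⟩ := hleaf m hm
    obtain rfl := (e.facts h).2.2.2 u hu
    obtain rfl := (e'.facts h).2.2.2 u hu'
    exact hlm (hb.leaf_unique h e e')
  have hs : ∑ d ∈ closedNbhd N L, net N (closedNbhd N L) d =
      ∑ l ∈ L, (net N (closedNbhd N L) l + ∑ u ∈ N l, net N (closedNbhd N L) u) := by
    conv_lhs => rw [closedNbhd]
    rw [sum_union (Finset.disjoint_left.2 hdis), sum_biUnion hpd, sum_add_distrib]
    rfl
  have hs' : ∑ l ∈ L, (10 : ℤ) ≤
      ∑ l ∈ L, (net N (closedNbhd N L) l + ∑ u ∈ N l, net N (closedNbhd N L) u) := by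
    refine sum_le_sum fun l hl => ?_
    obtain ⟨u, e⟩ := hleaf l hl
    have n1 := e.net h (mem_union_right L (hmem' e))
    have n2 := four_le_net h fun w hw => hclosed u (hmem' e) hw
    rw [show N l = {u} from e, sum_singleton]
    unfold closedNbhd at *
    omega
  simp at hs'
  omega

theorem Bad.not_adj_nb2 (hb : Bad N) (h : IsSubcubic N) (hl : ∀ l u, ¬ Nb1 N l u) {z a c y : V}
    (ez : Nb2 N z a c) (ea : Nb2 N a z y) : False := by
  have fz := ez.facts h
  have fa := ea.facts h
  obtain ⟨D, hD, key⟩ := hb.nb2 h ez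
  rw [hb.dmg_eq_empty h] at key
  simp only [card_empty] at key
  by_cases hy : y = c
  · subst hy
    have n1 := ea.net' (D := D) h (by grind) (by grind)
    have n2 := three_le_net (D := D) (d := y) h z a (by grind) (by grind) (by grind) (by grind)
      (by grind)
    have hi : #(iso N D) ≤ 1 := by
      rcases nb_cases₂ h fz.2.2.2.1 fa.2.2.2.1 fz.2.2.2.2.1 with e | ⟨d, e⟩
      · have := e.facts h
        refine card_le_one_of y fun u hu => ?_
        have := mem_outer' h (iso_subset hu)
        grind
      · have := e.facts h
        refine card_le_one_of d fun u hu => ?_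
        have := mem_outer' h (iso_subset hu)
        grind
    omega
  · have n1 := ea.net (D := D) h (by grind)
    have n2 := two_le_net (D := D) (d := c) h z (by grind) (by grind)
    have hi : ∀ u ∈ iso N D, u = y ∧ Nb2 N y a c := by
      intro u hu
      have m := mem_iso' h hu
      have hs := fun w => h.symm w u
      have hm : ∀ w ∈ N u, w = a ∨ w = c := by grind
      have ha : a ∈ N u := by
        by_contra ha
        exact hl u c (nb1_of (by grind) (by grind))
      have hc : c ∈ N u := by
        by_contra hc
        exact hl u a (nb1_of (by grind) (by grind))
      obtain rfl : u = y := by grind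
      exact ⟨rfl, nb2_of ha hc (by grind) hm⟩
    have hi' : #(iso N D) ≤ 1 := card_le_one_of y fun u hu => (hi u hu).1
    rcases nb_cases h fz.2.2.2.1 with e | ⟨d, e⟩ | ⟨d, d', e⟩
    · exact hl _ _ e
    · have n2 := e.net (D := D) h (by grind)
      omega
    · have hne : (iso N D).Nonempty := card_pos.1 (by omega)
      obtain ⟨u, hu⟩ := hne
      obtain ⟨-, ey⟩ := hi u hu
      have fy := ey.facts h
      obtain ⟨D, hD, key⟩ := hb.nb2 h ea
      rw [hb.dmg_eq_empty h] at key
      simp only [card_empty] at key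
      have n1 := ez.net (D := D) h (by grind)
      have n2 := ey.net (D := D) h (by grind)
      have hi : #(iso N D) ≤ 1 := card_le_one_of c fun u hu => by
        have := mem_outer' h (iso_subset hu)
        grind
      omega

theorem Bad.nb3_of_nb2 (hb : Bad N) (h : IsSubcubic N) (hl : ∀ l u, ¬ Nb1 N l u) {z a c : V}
    (ez : Nb2 N z a c) : ∃ p q, Nb3 N a z p q := by
  rcases nb_cases h (ez.facts h).2.2.1 with e | ⟨d, e⟩ | e
  · exact (hl _ _ e).elim
  · exact (hb.not_adj_nb2 h hl ez e).elim
  · exact e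

theorem Bad.not_square (hb : Bad N) (h : IsSubcubic N) (hl : ∀ l u, ¬ Nb1 N l u)
    {a v a₂ b c z b₂ c₂ : V} (ea : Nb2 N a v a₂) (ev : Nb3 N v a b c) (ez : Nb2 N z b c)
    (eb : Nb3 N b v z b₂) (ec : Nb3 N c v z c₂) (hab : a ∉ N b) (hac : a ∉ N c) (hbc : b ∉ N c)
    (h₂ : a₂ ≠ b₂) : False := by
  have fa := ea.facts h
  have fv := ev.facts h
  have fz := ez.facts h
  have fb := eb.facts h
  have fc := ec.facts h
  have htw : b₂ ≠ c₂ := by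
    rintro rfl
    exact hb.twin_ne h fz.2.2.2.2.2.2.1 eb ec
  obtain ⟨D, hD, key⟩ := hb.nb3 h eb
  rw [hb.dmg_eq_empty h] at key
  simp only [card_empty] at key
  have n1 := two_le_net (D := D) (d := v) h b (by grind) (by grind)
  have n2 := ez.net (D := D) h (by grind)
  have n3 := two_le_net (D := D) (d := b₂) h b (by grind) (by grind)
  have hi : #(iso N D) ≤ 0 := card_le_zero_of fun u hu => by
    have m := mem_iso' h hu
    have hs := fun w => h.symm w u
    by_cases hua : u = a
    · subst hua
      have := m.2.2 a₂ (by grind)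
      grind
    by_cases huc : u = c
    · subst huc
      have := m.2.2 c₂ (by grind)
      grind
    exact hl u b₂ (nb1_of (by grind) (by grind))
  omega

theorem Bad.not_nb2 (hb : Bad N) (h : IsSubcubic N) (hl : ∀ l u, ¬ Nb1 N l u) {a v a₂ : V} :
    ¬ Nb2 N a v a₂ := by
  intro ea
  obtain ⟨b, c, ev⟩ := hb.nb3_of_nb2 h hl ea
  have fa := ea.facts h
  have fv := ev.facts h
  obtain ⟨D, hD, key⟩ := hb.nb3 h ev
  rw [hb.dmg_eq_empty h] at key
  simp only [card_empty] at key
  have n1 := ea.net (D := D) h (by grind)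
  have n2 := two_le_net (D := D) (d := b) h v (by grind) (by grind)
  have n3 := two_le_net (D := D) (d := c) h v (by grind) (by grind)
  have hi : ∀ u ∈ iso N D, Nb2 N u b c := by
    intro u hu
    have m := mem_iso' h hu
    have hs := fun w => h.symm w u
    have hm : ∀ w ∈ N u, w = a ∨ w = b ∨ w = c := by grind
    by_cases ha : a ∈ N u
    · exfalso
      have hua : u = a₂ := by grind
      obtain ⟨p, q, e⟩ := hb.nb3_of_nb2 h hl ea.swap
      have f := e.facts h
      subst hua
      exact hb.twin_ne h (show v ≠ u by grind) ev
        (nb_cases₃ h ha (by grind) (by grind) (by grind) (by grind) (by grind))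
    have hbu : b ∈ N u := by
      by_contra hbu
      exact hl u c (nb1_of (by grind) (by grind))
    have hcu : c ∈ N u := by
      by_contra hcu
      exact hl u b (nb1_of (by grind) (by grind))
    exact nb2_of hbu hcu (by grind) (by grind)
  have hi' : #(iso N D) ≤ 1 := card_le_one.2 fun u hu w hw => by
    by_contra huw
    have f1 := (hi u hu).facts h
    have f2 := (hi w hw).facts h
    have m := (mem_iso' h hu).1
    have m' := (mem_iso' h hw).1
    exact hb.twin_ne h f1.2.2.2.2.2.2.1
      (nb_cases₃ h fv.2.2.2.2.1 f1.2.2.1 f2.2.2.1 (by grind) (by grind) huw)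
      (nb_cases₃ h fv.2.2.2.2.2.1 f1.2.2.2.1 f2.2.2.2.1 (by grind) (by grind) huw)
  obtain ⟨z, hz⟩ : (iso N D).Nonempty := card_pos.1 (by omega)
  have ez := hi z hz
  have fz := ez.facts h
  have hzD := (mem_iso' h hz).1
  have hab : a ∉ N b := fun hab => by
    have hab' := h.symm a b hab
    obtain rfl : b = a₂ := by grind
    have := ea.net' (D := D) h (by grind) (by grind)
    have := three_le_net (D := D) (d := b) h v a (by grind) (by grind) (by grind) (by grind)
      (by grind)
    omega
  have hac : a ∉ N c := fun hac => by
    have hac' := h.symm a c hac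
    obtain rfl : c = a₂ := by grind
    have := ea.net' (D := D) h (by grind) (by grind)
    have := three_le_net (D := D) (d := c) h v a (by grind) (by grind) (by grind) (by grind)
      (by grind)
    omega
  have hbc : b ∉ N c := fun hbc => by
    have hbc' := h.symm b c hbc
    have := three_le_net (D := D) (d := b) h v c (by grind) (by grind) (by grind) (by grind)
      (by grind)
    have := three_le_net (D := D) (d := c) h v b (by grind) (by grind) (by grind) (by grind)
      (by grind)
    omega
  have third : ∀ b c, Nb3 N v a b c → Nb2 N z b c → ∃ b₂, Nb3 N b v z b₂ := by
    intro b c ev ez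
    have fz := ez.facts h
    have fv := ev.facts h
    refine (nb_cases₂ h fv.2.2.2.2.1 fz.2.2.1 (by grind)).resolve_left fun e => ?_
    obtain ⟨p, q, e'⟩ := hb.nb3_of_nb2 h hl ez
    have := e.card
    have := e'.card
    omega
  obtain ⟨b₂, eb⟩ := third b c ev ez
  obtain ⟨c₂, ec⟩ := third c b ev.rot.rot.swap ez.swap
  by_cases h₂ : a₂ = b₂
  · by_cases h₃ : a₂ = c₂
    · subst h₂ h₃
      exact hb.twin_ne h fz.2.2.2.2.2.2.1 eb ec
    · exact hb.not_square h hl ea ev.rot.rot.swap ez.swap ec eb hac hab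
        (fun hh => hbc (h.symm _ _ hh)) h₃
  · exact hb.not_square h hl ea ev ez eb ec hab hac hbc h₂

theorem not_bad [Fintype V] (h : IsSubcubic N) (hne : ∃ v, N v ≠ ∅) : ¬ Bad N := by
  intro hb
  have hl := hb.not_nb1 h
  obtain ⟨v, hv⟩ := hne
  have hdeg : ∀ v a, a ∈ N v → ∃ b c, Nb3 N v a b c := fun v a ha => by
    rcases nb_cases h ha with e | ⟨b, e⟩ | e
    · exact (hl _ _ e).elim
    · exact (hb.not_nb2 h hl e).elim
    · exact e
  obtain ⟨a, ha⟩ := nonempty_iff_ne_empty.2 hv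
  obtain ⟨b, c, ev⟩ := hdeg v a ha
  have fv := ev.facts h
  obtain ⟨D, hD, key⟩ := hb.nb3 h ev
  rw [hb.dmg_eq_empty h] at key
  simp only [card_empty] at key
  have n1 := two_le_net (D := D) (d := a) h v (by grind) (by grind)
  have n2 := two_le_net (D := D) (d := b) h v (by grind) (by grind)
  have n3 := two_le_net (D := D) (d := c) h v (by grind) (by grind)
  obtain ⟨z, hz⟩ : (iso N D).Nonempty := card_pos.1 (by omega)
  obtain ⟨hzD, ⟨w, hw, -⟩, hm⟩ := mem_iso' h hz
  obtain ⟨w', w'', ez⟩ := hdeg z w hw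
  have hs := fun w => h.symm w z
  have hm' : N z ⊆ {a, b, c} := fun w hw => by grind
  have he : N z = {a, b, c} := eq_of_subset_of_card_le hm' (by rw [← ev.1, ev.card, ez.card])
  exact hb.twin_ne h (show v ≠ z by grind) ev ⟨he, ev.2⟩

theorem del_subset (u : V) : del N D u ⊆ N u := by
  unfold del; split_ifs <;> simp

theorem del_eq (h : IsSubcubic N) {a : V} (ha : #(del N D a) = 3) : del N D a = N a :=
  eq_of_subset_of_card_le (del_subset a) (by have := h.card_le a; omega)

theorem IsSubcubic.del (h : IsSubcubic N) : IsSubcubic (del N D) where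
  symm u v huv := by
    have := h.symm u v
    unfold IndepDom.del at *
    split_ifs at * <;> simp_all
  irrefl v hv := h.irrefl v (del_subset v hv)
  card_le v := (card_le_card (del_subset v)).trans (h.card_le v)
  noK33 a b c hab hac hbc e1 e2 h3 := by
    have ha := del_eq h h3
    have hb := del_eq h (e1 ▸ h3)
    have hc := del_eq h (e2 ▸ h3)
    exact h.noK33 a b c hab hac hbc (by rw [← ha, ← hb, e1]) (by rw [← ha, ← hc, e2]) (ha ▸ h3)

theorem wt_del_le (h : IsSubcubic N) {u : V} (hu : u ∉ D) :
    wt (del N D) u ≤ wt N u + #(N u ∩ D) + 3 * (if u ∈ iso N D then 1 else 0) +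
      (if u ∈ dmg N D then 1 else 0) := by
  have hk := card_inter_add_card_sdiff (N u) D
  have hd : del N D u = N u \ D := by simp [del, hu]
  have h7 := wt_ge h u
  have h3 := h.card_le u
  have hout : N u ∩ D ≠ ∅ → u ∈ outer N D := by
    intro hne
    obtain ⟨d, hd⟩ := Finset.nonempty_iff_ne_empty.2 hne
    exact (mem_outer h).2 ⟨hu, d, by simp_all⟩
  rcases Nat.eq_zero_or_pos #(N u ∩ D) with h0 | h0
  · have e : del N D u = N u := by
      rw [hd, Finset.sdiff_eq_self_iff_disjoint, disjoint_iff_inter_eq_empty, ← card_eq_zero, h0]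
    have : Twin (del N D) u → Twin N u := by
      rintro ⟨a, ha, b, hb, hab, e', h3⟩
      have h1 := del_eq h h3
      have h2 := del_eq h (e' ▸ h3)
      exact ⟨a, e ▸ ha, b, e ▸ hb, hab, by rw [← h1, ← h2, e'], h1 ▸ h3⟩
    have : wt (del N D) u ≤ wt N u := by
      unfold wt
      rw [e]
      split_ifs <;> grind
    omega
  · have ho := hout (by intro h; simp [h] at h0)
    rcases Nat.lt_or_ge #(N u \ D) 2 with h2 | h2
    · rcases Nat.eq_zero_or_pos #(N u \ D) with hz | hz
      · have : u ∈ iso N D := by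
          simp only [iso, mem_filter]
          refine ⟨ho, hu, ?_, sdiff_eq_empty_iff_subset.1 (card_eq_zero.1 hz)⟩
          intro h; simp [h] at h0
        have : wt (del N D) u = 10 := by unfold wt; rw [hd, if_pos hz]
        simp_all
        omega
      · have : wt (del N D) u = 6 := by
          unfold wt; rw [hd, if_neg (by omega), if_pos (by omega)]
        have : 6 ≤ wt N u + #(N u ∩ D) := by
          unfold wt
          split_ifs <;> omega
        omega
    · have h2 : #(N u \ D) = 2 := by omega
      have hw : wt N u = 4 := by
        unfold wt
        rw [if_neg (by omega), if_neg (by omega), if_neg (by omega)]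
      by_cases ht : Twin (del N D) u
      · have : u ∈ dmg N D := by
          simp only [dmg, mem_filter]
          refine ⟨ho, hu, ?_⟩
          obtain ⟨a, ha, b, hb, hab, e', h3⟩ := ht
          have h1 := del_eq h h3
          have h2' := del_eq h (e' ▸ h3)
          obtain ⟨d, hd'⟩ := card_pos.1 h0
          have hdis : ∀ w ∈ N a, w ∉ D := by
            rw [← h1]
            unfold del
            split_ifs <;> simp
          simp only [hd, mem_sdiff, mem_inter] at ha hb hd'
          have h4 : d ≠ a := by rintro rfl; exact ha.2 hd'.2
          have h5 : d ≠ b := by rintro rfl; exact hb.2 hd'.2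
          refine ⟨d, a, b, ?_, h4, h5, hab, hd'.2, ha.2, hb.2, by rw [← h1, ← h2', e'],
            h1 ▸ h3, Finset.disjoint_left.2 fun _ => hdis _⟩
          symm
          apply eq_of_subset_of_card_le
          · simp [insert_subset_iff, *]
          · rw [card_eq_three.2 ⟨d, a, b, h4, h5, hab, rfl⟩]; omega
        have : wt (del N D) u ≤ 6 := by
          unfold wt; rw [hd, if_neg (by omega), if_neg (by omega), if_pos h2]
          split_ifs <;> omega
        simp_all
        omega
      · have : wt (del N D) u = 5 := by
          unfold wt; rw [hd, if_neg (by omega), if_neg (by omega), if_pos h2, if_neg ht]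
        omega

theorem sum_wt_del (h : IsSubcubic N) {W : Finset V} (hW : ∀ v, N v ⊆ W) (hD : D ⊆ W) :
    (∑ u ∈ W \ D, wt (del N D) u : ℤ) + ∑ d ∈ D, net N D d ≤
      ∑ u ∈ W, wt N u + 3 * #(iso N D) + #(dmg N D) := by
  have h1 : (∑ u ∈ W \ D, wt (del N D) u) ≤
      ∑ u ∈ W \ D, wt N u + ∑ u ∈ W \ D, #(N u ∩ D) + 3 * #(iso N D) + #(dmg N D) := by
    refine (sum_le_sum fun u hu => wt_del_le h (mem_sdiff.1 hu).2).trans ?_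
    rw [sum_add_distrib, sum_add_distrib, sum_add_distrib, ← mul_sum, sum_boole, sum_boole]
    simp only [Nat.cast_id]
    gcongr <;> intro x <;> simp
  have h2 : ∑ u ∈ W \ D, #(N u ∩ D) = ∑ d ∈ D, #(N d \ D) := by
    have := sum_card_bipartiteAbove_eq_sum_card_bipartiteBelow (s := W \ D) (t := D)
      (fun u d => d ∈ N u)
    unfold bipartiteAbove bipartiteBelow at this
    convert this using 2 with u hu d hd
    · congr 1; ext; simp [and_comm]
    · congr 1; ext x
      have := h.symm x d
      have := h.symm d x
      have := @hW d x
      simp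
      tauto
  have h3 := sum_sdiff (f := fun u => wt N u) hD
  unfold net
  rw [sum_sub_distrib]
  push_cast [← h3]
  zify at h1 h2
  linarith

end

theorem exists_indep_dom [Fintype V] (n : ℕ) : ∀ (N : V → Finset V) (W : Finset V), #W = n → IsSubcubic N → (∀ v, N v ⊆ W) →
    ∃ I ⊆ W, (∀ v ∈ W, v ∉ I → ∃ u ∈ I, u ∈ N v) ∧ (∀ u ∈ I, ∀ v ∈ I, u ∉ N v) ∧
      10 * #I ≤ ∑ v ∈ W, wt N v := by
  induction n using Nat.strong_induction_on with
  | _ n ih =>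
  intro N W hn h hW
  by_cases hiso : ∃ v ∈ W, N v = ∅
  · obtain ⟨v, hv, hv0⟩ := hiso
    obtain ⟨I, hI, hdom, hind, hle⟩ := ih #(W.erase v)
      (by rw [← hn]; exact card_lt_card (erase_ssubset hv)) N (W.erase v) rfl h
      (fun u x hx => mem_erase.2 ⟨by
        rintro rfl
        have := h.symm _ _ hx
        simp [hv0] at this, hW u hx⟩)
    have hvI : v ∉ I := fun h => by simpa using hI h
    refine ⟨insert v I, ?_, ?_, ?_, ?_⟩
    · exact insert_subset hv (hI.trans (erase_subset _ _))
    · intro w hw hw'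
      rw [mem_insert, not_or] at hw'
      obtain ⟨u, hu, hu'⟩ := hdom w (mem_erase.2 ⟨hw'.1, hw⟩) hw'.2
      exact ⟨u, mem_insert_of_mem hu, hu'⟩
    · have h1 : ∀ u, v ∉ N u := fun u hu => by simpa [hv0] using h.symm _ _ hu
      intro a ha b hb
      rcases mem_insert.1 ha with rfl | ha
      · exact h1 _
      · rcases mem_insert.1 hb with rfl | hb
        · simp [hv0]
        · exact hind a ha b hb
    · rw [card_insert_of_notMem hvI, ← add_sum_erase _ _ hv]
      have : wt N v = 10 := by simp [wt, hv0]
      omega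
  · by_cases hne : ∃ v, N v ≠ ∅
    · have := not_bad h hne
      unfold Bad at this
      push Not at this
      obtain ⟨J, hJ, hJ0, hJi, hle⟩ := this
      set D := closedNbhd N J with hD
      have hDW : D ⊆ W := by
        intro x hx
        simp only [hD, closedNbhd, mem_union, mem_biUnion] at hx
        rcases hx with hx | ⟨y, -, hx⟩
        · obtain ⟨y, hy⟩ := hJ0 x hx
          exact hW y (h.symm _ _ hy)
        · exact hW y hx
      have hJD : J ⊆ D := subset_union_left
      have hDne : D.Nonempty := hJ.mono hJD
      obtain ⟨I, hI, hdom, hind, hle'⟩ := ih #(W \ D)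
        (by rw [← hn]; exact card_lt_card (sdiff_ssubset hDW hDne)) (del N D) (W \ D) rfl h.del
        (fun u x hx => by
          have := hW u (del_subset u hx)
          unfold del at hx
          split_ifs at hx <;> simp_all)
      have hsum := sum_wt_del h hW hDW
      have hID : ∀ u ∈ I, u ∉ D := fun u hu => (mem_sdiff.1 (hI hu)).2
      have hdis : Disjoint J I := Finset.disjoint_left.2 fun x hx hx' => hID x hx' (hJD hx)
      have hcross : ∀ a ∈ J, ∀ b ∈ I, b ∉ N a := fun a ha b hb hab =>
        hID b hb (mem_union_right _ (mem_biUnion.2 ⟨a, ha, hab⟩))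
      refine ⟨J ∪ I, ?_, ?_, ?_, ?_⟩
      · exact union_subset (hJD.trans hDW) (hI.trans sdiff_subset)
      · intro v hv hv'
        rw [mem_union, not_or] at hv'
        by_cases hvD : v ∈ D
        · simp only [hD, closedNbhd, mem_union, mem_biUnion] at hvD
          obtain ⟨y, hy, hy'⟩ := hvD.resolve_left hv'.1
          exact ⟨y, mem_union_left _ hy, h.symm _ _ hy'⟩
        · obtain ⟨u, hu, hu'⟩ := hdom v (mem_sdiff.2 ⟨hv, hvD⟩) hv'.2
          exact ⟨u, mem_union_right _ hu, del_subset _ hu'⟩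
      · intro a ha b hb hab
        rcases mem_union.1 ha with ha | ha <;> rcases mem_union.1 hb with hb | hb
        · exact hJi a ha b hb hab
        · exact hcross a ha b hb (h.symm _ _ hab)
        · exact hcross b hb a ha hab
        · refine hind a ha b hb ?_
          simp [del, hID b hb, hab, hID a ha]
      · rw [card_union_of_disjoint hdis]
        zify at *
        linarith
    · push Not at hne
      refine ⟨∅, by simp, ?_, by simp, by simp⟩
      intro v hv
      exact absurd ⟨v, hv, hne v⟩ hiso

theorem iso_K33 {V : Type*} [Fintype V] (G : SimpleGraph V) (N : V → Finset V)
    (hN : ∀ u v, u ∈ N v ↔ G.Adj u v) (hconn : G.Connected) (h3 : ∀ v, #(N v) = 3)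
    {a b c : V} (hab : a ≠ b) (hac : a ≠ c) (hbc : b ≠ c) (e1 : N a = N b) (e2 : N a = N c) :
    Nonempty (G ≃g completeBipartiteGraph (Fin 3) (Fin 3)) := by
  classical
  obtain ⟨x, y, z, hxy, hxz, hyz, e⟩ := card_eq_three.1 (h3 a)
  have hs : ∀ u v, u ∈ N v → v ∈ N u := fun u v h => (hN _ _).2 ((hN _ _).1 h).symm
  have hX : ∀ w ∈ N a, N w = {a, b, c} := by
    intro w hw
    symm
    apply eq_of_subset_of_card_le
    · have := hs _ _ hw
      have := hs _ _ (e1 ▸ hw)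
      have := hs _ _ (e2 ▸ hw)
      simp only [insert_subset_iff, singleton_subset_iff]
      exact ⟨‹_›, ‹_›, ‹_›⟩
    · rw [h3, card_eq_three.2 ⟨a, b, c, hab, hac, hbc, rfl⟩]
  have hx := hX x (by simp [e])
  have hy := hX y (by simp [e])
  have hz := hX z (by simp [e])
  have hb : N b = {x, y, z} := by rw [← e1, e]
  have hc : N c = {x, y, z} := by rw [← e2, e]
  have hall : ∀ v, v ∈ ({a, b, c, x, y, z} : Finset V) := by
    intro v
    obtain ⟨p⟩ := hconn.preconnected a v
    have key : ∀ u v (p : G.Walk u v), u ∈ ({a, b, c, x, y, z} : Finset V) →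
        v ∈ ({a, b, c, x, y, z} : Finset V) := by
      intro u v p
      induction p with
      | nil => exact id
      | cons h p ih =>
        intro hu
        apply ih
        have := (hN _ _).2 h.symm
        simp only [mem_insert, mem_singleton] at hu
        rcases hu with rfl | rfl | rfl | rfl | rfl | rfl <;> simp_all <;> tauto
    exact key a v p (by simp)
  have hirr : ∀ v, v ∉ N v := fun v h => G.irrefl ((hN _ _).1 h)
  have hax : ∀ s ∈ N a, s ≠ a ∧ s ≠ b ∧ s ≠ c := by
    intro s hs
    refine ⟨?_, ?_, ?_⟩ <;> rintro rfl
    · exact hirr _ hs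
    · exact hirr _ (e1 ▸ hs)
    · exact hirr _ (e2 ▸ hs)
  have hx' := hax x (by simp [e])
  have hy' := hax y (by simp [e])
  have hz' := hax z (by simp [e])
  let f : Fin 3 ⊕ Fin 3 → V := Sum.elim ![a, b, c] ![x, y, z]
  have hf : Function.Bijective f := by
    constructor
    · rintro (i | i) (j | j) <;> fin_cases i <;> fin_cases j <;> simp [f] <;> grind
    · intro v
      have := hall v
      simp only [mem_insert, mem_singleton] at this
      rcases this with rfl | rfl | rfl | rfl | rfl | rfl
      · exact ⟨.inl 0, rfl⟩
      · exact ⟨.inl 1, rfl⟩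
      · exact ⟨.inl 2, rfl⟩
      · exact ⟨.inr 0, rfl⟩
      · exact ⟨.inr 1, rfl⟩
      · exact ⟨.inr 2, rfl⟩
  refine ⟨RelIso.symm ⟨Equiv.ofBijective f hf, ?_⟩⟩
  intro i j
  rw [← hN]
  rcases i with i | i <;> rcases j with j | j <;> fin_cases i <;> fin_cases j <;>
    simp [f, completeBipartiteGraph, e, hb, hc, hx, hy, hz] <;> grind

theorem five_mul_indepDomNum_le {V : Type*} [Fintype V] (G : SimpleGraph V)
    (hconn : G.Connected) (hcubic : ∀ v : V, Nat.card (G.neighborSet v) = 3)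
    (hK33 : ¬ Nonempty (G ≃g completeBipartiteGraph (Fin 3) (Fin 3))) :
    5 * indepDomNum G ≤ 2 * Fintype.card V := by
  classical
  have h3 : ∀ v, #(G.neighborFinset v) = 3 := by
    intro v
    rw [← hcubic v, Nat.card_eq_fintype_card, card_neighborFinset_eq_degree,
      card_neighborSet_eq_degree]
  have hN : ∀ u v, u ∈ G.neighborFinset v ↔ G.Adj u v := fun u v => by
    rw [mem_neighborFinset, G.adj_comm]
  have hsub : IsSubcubic fun v => G.neighborFinset v :=
    { symm := fun u v h => (hN _ _).2 ((hN _ _).1 h).symm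
      irrefl := fun v h => G.irrefl ((hN _ _).1 h)
      card_le := fun v => (h3 v).le
      noK33 := fun a b c hab hac hbc e1 e2 _ =>
        hK33 (iso_K33 G _ hN hconn h3 hab hac hbc e1 e2) }
  obtain ⟨I, -, hdom, hind, hle⟩ := exists_indep_dom _ _ univ rfl hsub
    (fun _ => subset_univ _)
  have hw : ∀ v, wt (fun v => G.neighborFinset v) v = 4 := fun v => by
    simp [wt, -card_neighborFinset_eq_degree, h3]
  simp only [hw, sum_const, smul_eq_mul, card_univ] at hle
  have : indepDomNum G ≤ #I :=
    Nat.sInf_le ⟨I, ⟨fun v hv => by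
      obtain ⟨u, hu, hu'⟩ := hdom v (mem_univ v) (by simpa using hv)
      exact ⟨u, by simpa using hu, (hN _ _).1 hu'⟩, fun u hu v hv h =>
      hind u (by simpa using hu) v (by simpa using hv) ((hN _ _).2 h)⟩, Set.ncard_coe_finset I⟩
  omega

end IndepDom

/-- If `G` is a connected cubic graph of order `n` not isomorphic to `K_{3,3}`,
then `i(G) ≤ (2/5) n`. -/
theorem stmt_2 {V : Type*} [Fintype V] (G : SimpleGraph V)
    (hconn : G.Connected) (hcubic : ∀ v : V, Nat.card (G.neighborSet v) = 3)
    (hK33 : ¬ Nonempty (G ≃g completeBipartiteGraph (Fin 3) (Fin 3))) :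
    5 * indepDomNum G ≤ 2 * Fintype.card V := by
  exact IndepDom.five_mul_indepDomNum_le G hconn hcubic hK33
end

section
/- The 5-prism C_5 □ K_2 (the Cartesian product of the 5-cycle with K_2), which is a connected cubic graph of order 10, has independent domination number exactly 4, so that i(C_5 □ K_2) = (2/5)·10. -/
open SimpleGraph

instance {V W : Type*} [DecidableEq V] [DecidableEq W] (G : SimpleGraph V) (H : SimpleGraph W)
    [DecidableRel G.Adj] [DecidableRel H.Adj] : DecidableRel (G □ H).Adj :=
  fun _ _ => decidable_of_iff' _ boxProd_adj

set_option synthInstance.maxSize 1000 in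
/-- An independent triple of vertices of the 5-prism, possibly with repetitions, leaves some
vertex undominated. -/
theorem prism_exists_undominated_of_indep_triple (a b c : Fin 5 × Fin 2)
    (hab : ¬ ((cycleGraph 5) □ (⊤ : SimpleGraph (Fin 2))).Adj a b)
    (hac : ¬ ((cycleGraph 5) □ (⊤ : SimpleGraph (Fin 2))).Adj a c)
    (hbc : ¬ ((cycleGraph 5) □ (⊤ : SimpleGraph (Fin 2))).Adj b c) :
    ∃ v, (v ≠ a ∧ v ≠ b ∧ v ≠ c) ∧
      ¬ ((cycleGraph 5) □ (⊤ : SimpleGraph (Fin 2))).Adj a v ∧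
      ¬ ((cycleGraph 5) □ (⊤ : SimpleGraph (Fin 2))).Adj b v ∧
      ¬ ((cycleGraph 5) □ (⊤ : SimpleGraph (Fin 2))).Adj c v := by
  revert a b c
  decide +kernel

theorem Set.exists_eq_triple_of_ncard_le_three {V : Type*} [Finite V] {S : Set V}
    (hne : S.Nonempty) (hS : S.ncard ≤ 3) : ∃ a b c, S = {a, b, c} := by
  have hpos := (Set.ncard_pos S.toFinite).2 hne
  obtain h | h | h : S.ncard = 1 ∨ S.ncard = 2 ∨ S.ncard = 3 := by omega
  · obtain ⟨a, rfl⟩ := Set.ncard_eq_one.1 h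
    exact ⟨a, a, a, by simp⟩
  · obtain ⟨a, b, -, rfl⟩ := Set.ncard_eq_two.1 h
    exact ⟨a, b, b, by simp⟩
  · obtain ⟨a, b, c, -, -, -, rfl⟩ := Set.ncard_eq_three.1 h
    exact ⟨a, b, c, rfl⟩

theorem IsIndepDomSet.nonempty {V : Type*} [Nonempty V] {G : SimpleGraph V} {S : Set V}
    (hS : IsIndepDomSet G S) : S.Nonempty := by
  inhabit V
  by_cases h : default ∈ S
  · exact ⟨_, h⟩
  · obtain ⟨u, hu, -⟩ := hS.1 _ h
    exact ⟨u, hu⟩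

theorem four_le_ncard_of_isIndepDomSet_prism {S : Set (Fin 5 × Fin 2)}
    (hS : IsIndepDomSet ((cycleGraph 5) □ (⊤ : SimpleGraph (Fin 2))) S) : 4 ≤ S.ncard := by
  by_contra! hlt
  obtain ⟨a, b, c, rfl⟩ := Set.exists_eq_triple_of_ncard_le_three hS.nonempty (by omega)
  obtain ⟨v, hv, hav, hbv, hcv⟩ := prism_exists_undominated_of_indep_triple a b c
    (hS.2 a (by simp) b (by simp)) (hS.2 a (by simp) c (by simp)) (hS.2 b (by simp) c (by simp))
  obtain ⟨u, hu, huv⟩ := hS.1 v (by simpa using hv)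
  obtain rfl | rfl | rfl : u = a ∨ u = b ∨ u = c := by simpa using hu
  exacts [hav huv, hbv huv, hcv huv]

theorem isIndepDomSet_prism :
    IsIndepDomSet ((cycleGraph 5) □ (⊤ : SimpleGraph (Fin 2)))
      (({(0, 0), (2, 0), (1, 1), (3, 1)} : Finset (Fin 5 × Fin 2)) : Set (Fin 5 × Fin 2)) := by
  simp only [IsIndepDomSet, Finset.mem_coe]
  decide +kernel

/-- The 5-prism `C₅ □ K₂` is a connected cubic graph of order 10 with
independent domination number exactly 4, so `i(C₅ □ K₂) = (2/5)·10`. -/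
theorem stmt_3 :
    ((cycleGraph 5) □ (⊤ : SimpleGraph (Fin 2))).Connected ∧
    (∀ v : Fin 5 × Fin 2,
      Nat.card (((cycleGraph 5) □ (⊤ : SimpleGraph (Fin 2))).neighborSet v) = 3) ∧
    Fintype.card (Fin 5 × Fin 2) = 10 ∧
    indepDomNum ((cycleGraph 5) □ (⊤ : SimpleGraph (Fin 2))) = 4 := by
  refine ⟨cycleGraph_connected.boxProd connected_top, fun v => ?_, by simp, ?_⟩
  · rw [Nat.card_eq_fintype_card]
    revert v
    decide +kernel
  · refine IsLeast.csInf_eq ⟨⟨_, isIndepDomSet_prism, ?_⟩, ?_⟩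
    · rw [Set.ncard_coe_finset]
      rfl
    · rintro k ⟨S, hS, rfl⟩
      exact four_le_ncard_of_isIndepDomSet_prism hS
end

section
/- For every integer k ≥ 1, let G_k be the graph obtained by taking two disjoint copies of the cycle C_{4k}, with respective vertex sequences a_1 b_1 c_1 d_1 … a_k b_k c_k d_k and w_1 x_1 y_1 z_1 … w_k x_k y_k z_k, and joining a_i to w_i, b_i to x_i, c_i to z_i, and d_i to y_i for each i ∈ {1,…,k}. Then G_k is a connected cubic graph of order n = 8k and i(G_k) = 3k = (3/8)n. -/
open SimpleGraph

/-- The graph `gFam k`: two disjoint copies of the cycle `C_{4k}`.  A vertex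
`(i, r, j)` is the `r`-th vertex of the `i`-th block of copy `j`; in copy `0`
the blocks read `aᵢ bᵢ cᵢ dᵢ` (`r = 0,1,2,3`) and in copy `1` they read
`wᵢ xᵢ yᵢ zᵢ`.  Cycle edges join consecutive vertices, and the cross edges
join `aᵢ–wᵢ`, `bᵢ–xᵢ`, `cᵢ–zᵢ` and `dᵢ–yᵢ`. -/
def gFam (k : ℕ) : SimpleGraph (ZMod k × ZMod 4 × Fin 2) :=
  SimpleGraph.fromRel (fun p q =>
    -- edges of the two cycles `C_{4k}`
    (p.2.2 = q.2.2 ∧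
      ((p.2.1 ≠ 3 ∧ q.1 = p.1 ∧ q.2.1 = p.2.1 + 1) ∨
       (p.2.1 = 3 ∧ q.1 = p.1 + 1 ∧ q.2.1 = 0))) ∨
    -- the cross edges `aᵢ–wᵢ`, `bᵢ–xᵢ`, `cᵢ–zᵢ`, `dᵢ–yᵢ`
    (p.2.2 = 0 ∧ q.2.2 = 1 ∧ q.1 = p.1 ∧
      ((p.2.1 = 0 ∧ q.2.1 = 0) ∨ (p.2.1 = 1 ∧ q.2.1 = 1) ∨
       (p.2.1 = 2 ∧ q.2.1 = 3) ∨ (p.2.1 = 3 ∧ q.2.1 = 2))))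

namespace gFam

/-- The vertices of `gFam k`. -/
abbrev Vert (k : ℕ) := ZMod k × ZMod 4 × Fin 2

/-- The successor of a vertex on its cycle. -/
def next {k : ℕ} (p : Vert k) : Vert k :=
  if p.2.1 = 3 then (p.1 + 1, 0, p.2.2) else (p.1, p.2.1 + 1, p.2.2)

/-- The predecessor of a vertex on its cycle. -/
def prev {k : ℕ} (p : Vert k) : Vert k :=
  if p.2.1 = 0 then (p.1 - 1, 3, p.2.2) else (p.1, p.2.1 - 1, p.2.2)

/-- The neighbor of a vertex on the other cycle. -/
def cross {k : ℕ} (p : Vert k) : Vert k :=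
  (p.1, if p.2.1 = 2 then 3 else if p.2.1 = 3 then 2 else p.2.1, 1 - p.2.2)

lemma zmod_four_cases (r : ZMod 4) : r = 0 ∨ r = 1 ∨ r = 2 ∨ r = 3 := by
  revert r; decide

lemma zmod_four_simps :
    (0 : ZMod 4) ≠ 1 ∧ (0 : ZMod 4) ≠ 2 ∧ (0 : ZMod 4) ≠ 3 ∧ (1 : ZMod 4) ≠ 0 ∧
      (1 : ZMod 4) ≠ 2 ∧ (1 : ZMod 4) ≠ 3 ∧ (2 : ZMod 4) ≠ 0 ∧ (2 : ZMod 4) ≠ 1 ∧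
      (2 : ZMod 4) ≠ 3 ∧ (3 : ZMod 4) ≠ 0 ∧ (3 : ZMod 4) ≠ 1 ∧ (3 : ZMod 4) ≠ 2 ∧
      (1 : ZMod 4) + 1 = 2 ∧ (2 : ZMod 4) + 1 = 3 ∧ (3 : ZMod 4) - 1 = 2 ∧ (2 : ZMod 4) - 1 = 1 := by
  decide

set_option maxHeartbeats 1000000 in
lemma adj_iff {k : ℕ} (p q : Vert k) :
    (gFam k).Adj p q ↔ q = next p ∨ q = prev p ∨ q = cross p := by
  obtain ⟨i, r, j⟩ := p
  obtain ⟨i', r', j'⟩ := q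
  have hi : i' = i - 1 ↔ i = i' + 1 := by
    rw [eq_sub_iff_add_eq, eq_comm]
  rcases zmod_four_cases r with rfl | rfl | rfl | rfl <;>
  rcases zmod_four_cases r' with rfl | rfl | rfl | rfl <;>
  fin_cases j <;> fin_cases j' <;>
  simp [gFam, next, prev, cross, zmod_four_simps, hi, eq_comm]

lemma card_neighborSet {k : ℕ} (p : Vert k) : Nat.card ((gFam k).neighborSet p) = 3 := by
  have h : (gFam k).neighborSet p = {next p, prev p, cross p} := by
    ext q
    simp [adj_iff]
  rw [h, Nat.card_coe_set_eq, Set.ncard_eq_three]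
  refine ⟨_, _, _, ?_, ?_, ?_, rfl⟩ <;>
  obtain ⟨i, r, j⟩ := p <;>
  rcases zmod_four_cases r with rfl | rfl | rfl | rfl <;>
  fin_cases j <;>
  simp [next, prev, cross, zmod_four_simps]

lemma connected {k : ℕ} [NeZero k] : (gFam k).Connected := by
  have hnext (p : Vert k) : (gFam k).Reachable p (next p) :=
    ((adj_iff _ _).2 (.inl rfl)).reachable
  have hcross (p : Vert k) : (gFam k).Reachable p (cross p) :=
    ((adj_iff _ _).2 (.inr (.inr rfl))).reachable
  have e1 (i : ZMod k) (j : Fin 2) : (gFam k).Reachable (i, 0, j) (i, 1, j) := by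
    simpa [next, zmod_four_simps] using hnext (i, 0, j)
  have e2 (i : ZMod k) (j : Fin 2) : (gFam k).Reachable (i, 0, j) (i, 2, j) :=
    (e1 i j).trans (by simpa [next, zmod_four_simps] using hnext (i, 1, j))
  have e3 (i : ZMod k) (j : Fin 2) : (gFam k).Reachable (i, 0, j) (i, 3, j) :=
    (e2 i j).trans (by simpa [next, zmod_four_simps] using hnext (i, 2, j))
  have e4 (i : ZMod k) (j : Fin 2) : (gFam k).Reachable (i, 0, j) (i + 1, 0, j) :=
    (e3 i j).trans (by simpa [next] using hnext (i, 3, j))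
  have hblock (n : ℕ) : (gFam k).Reachable (0, 0, 0) ((n : ZMod k), 0, 0) := by
    induction n with
    | zero => simp
    | succ n ih => simpa using ih.trans (e4 n 0)
  have hcopy (i : ZMod k) (j : Fin 2) : (gFam k).Reachable (0, 0, 0) (i, 0, j) := by
    have h := hblock i.val
    rw [ZMod.natCast_zmod_val] at h
    fin_cases j
    · exact h
    · exact h.trans (by simpa [cross, zmod_four_simps] using hcross (i, 0, 0))
  have hall (p : Vert k) : (gFam k).Reachable (0, 0, 0) p := by
    obtain ⟨i, r, j⟩ := p
    rcases zmod_four_cases r with rfl | rfl | rfl | rfl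
    · exact hcopy i j
    · exact (hcopy i j).trans (e1 i j)
    · exact (hcopy i j).trans (e2 i j)
    · exact (hcopy i j).trans (e3 i j)
  exact ⟨fun p q => (hall p).symm.trans (hall q)⟩

/-- A potential on the state between two blocks: `d` and `z` record which of the last vertices of
the left block are chosen, `a` and `w` which of the first vertices of the right block are. -/
def potential (d z a w : Bool) : ℕ := ((d && !w) || (z && !a)).toNat

set_option synthInstance.maxHeartbeats 0 in
set_option synthInstance.maxSize 10000 in
lemma block_bound : ∀ d₀ z₀ a b c d w x y z a₁ w₁ : Bool,
    (a || b || d₀ || w) = true → (b || c || a || x) = true → (c || d || b || z) = true →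
    (d || a₁ || c || y) = true → (w || x || z₀ || a) = true → (x || y || w || b) = true →
    (y || z || x || d) = true → (z || w₁ || y || c) = true →
    (d₀ && a) = false → (z₀ && w) = false → (a && b) = false → (b && c) = false →
    (c && d) = false → (w && x) = false → (x && y) = false → (y && z) = false →
    (a && w) = false → (b && x) = false → (c && z) = false → (d && y) = false →
    (d && a₁) = false → (z && w₁) = false →
    potential d z a₁ w₁ + 3 ≤ potential d₀ z₀ a w +
      (a.toNat + b.toNat + c.toNat + d.toNat + (w.toNat + x.toNat + y.toNat + z.toNat)) := by
  decide +kernel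

open Classical in
lemma ncard_eq_sum {k : ℕ} [NeZero k] (S : Set (Vert k)) :
    S.ncard = ∑ i : ZMod k, ∑ j : Fin 2, ∑ r : ZMod 4, (decide ((i, r, j) ∈ S)).toNat := by
  have hS : S = ((Finset.univ.filter (· ∈ S) : Finset (Vert k)) : Set (Vert k)) := by
    ext; simp
  conv_lhs => rw [hS]
  rw [Set.ncard_coe_finset, Finset.card_filter, Fintype.sum_prod_type]
  refine Finset.sum_congr rfl fun i _ => ?_
  rw [Fintype.sum_prod_type, Finset.sum_comm]
  refine Finset.sum_congr rfl fun j _ => Finset.sum_congr rfl fun r _ => ?_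
  by_cases h : (i, r, j) ∈ S <;> simp [h]

lemma sum_zmod_four (f : ZMod 4 → ℕ) : ∑ r, f r = f 0 + f 1 + f 2 + f 3 :=
  Fin.sum_univ_four f

lemma le_ncard {k : ℕ} [NeZero k] {S : Set (Vert k)} (hS : IsIndepDomSet (gFam k) S) :
    3 * k ≤ S.ncard := by
  classical
  let m (i : ZMod k) (r : ZMod 4) (j : Fin 2) : Bool := decide ((i, r, j) ∈ S)
  let P (i : ZMod k) : ℕ := potential (m (i - 1) 3 0) (m (i - 1) 3 1) (m i 0 0) (m i 0 1)
  have hdom (v : Vert k) : v ∈ S ∨ next v ∈ S ∨ prev v ∈ S ∨ cross v ∈ S := by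
    by_contra! h
    obtain ⟨u, hu, huv⟩ := hS.1 v h.1
    rcases (adj_iff _ _).1 huv.symm with rfl | rfl | rfl <;> simp_all
  have hn (v : Vert k) : ¬ (v ∈ S ∧ next v ∈ S) := fun h =>
    hS.2 _ h.1 _ h.2 ((adj_iff _ _).2 (.inl rfl))
  have hc (v : Vert k) : ¬ (v ∈ S ∧ cross v ∈ S) := fun h =>
    hS.2 _ h.1 _ h.2 ((adj_iff _ _).2 (.inr (.inr rfl)))
  have hblock (i : ZMod k) :
      P (i + 1) + 3 ≤ P i + ∑ j : Fin 2, ∑ r : ZMod 4, (m i r j).toNat := by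
    simp only [Fin.sum_univ_two, sum_zmod_four, P, add_sub_cancel_right]
    have D (r j) := hdom (i, r, j)
    have N (r j) := hn (i, r, j)
    have N' (j) := hn (i - 1, 3, j)
    have C (r) := hc (i, r, 0)
    apply block_bound
    · simpa [m, next, prev, cross, zmod_four_simps, or_assoc] using D 0 0
    · simpa [m, next, prev, cross, zmod_four_simps, or_assoc] using D 1 0
    · simpa [m, next, prev, cross, zmod_four_simps, or_assoc] using D 2 0
    · simpa [m, next, prev, cross, zmod_four_simps, or_assoc] using D 3 0
    · simpa [m, next, prev, cross, zmod_four_simps, or_assoc] using D 0 1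
    · simpa [m, next, prev, cross, zmod_four_simps, or_assoc] using D 1 1
    · simpa [m, next, prev, cross, zmod_four_simps, or_assoc] using D 2 1
    · simpa [m, next, prev, cross, zmod_four_simps, or_assoc] using D 3 1
    · simpa [m, next, cross, zmod_four_simps] using N' 0
    · simpa [m, next, cross, zmod_four_simps] using N' 1
    · simpa [m, next, cross, zmod_four_simps] using N 0 0
    · simpa [m, next, cross, zmod_four_simps] using N 1 0
    · simpa [m, next, cross, zmod_four_simps] using N 2 0
    · simpa [m, next, cross, zmod_four_simps] using N 0 1
    · simpa [m, next, cross, zmod_four_simps] using N 1 1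
    · simpa [m, next, cross, zmod_four_simps] using N 2 1
    · simpa [m, next, cross, zmod_four_simps] using C 0
    · simpa [m, next, cross, zmod_four_simps] using C 1
    · simpa [m, next, cross, zmod_four_simps] using C 2
    · simpa [m, next, cross, zmod_four_simps] using C 3
    · simpa [m, next, cross, zmod_four_simps] using N 3 0
    · simpa [m, next, cross, zmod_four_simps] using N 3 1
  have hsum := Finset.sum_le_sum fun i (_ : i ∈ Finset.univ) => hblock i
  have hshift : ∑ i : ZMod k, P (i + 1) = ∑ i, P i := Equiv.sum_comp (Equiv.addRight 1) P
  rw [Finset.sum_add_distrib, Finset.sum_add_distrib, hshift] at hsum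
  have hcard := ncard_eq_sum S
  simp only [Finset.sum_const, Finset.card_univ, ZMod.card, smul_eq_mul] at hsum
  simp only [m] at hsum
  omega

/-- The independent dominating set consisting of all `aᵢ`, `cᵢ` and `yᵢ`. -/
def domSet (k : ℕ) : Set (Vert k) :=
  {p | p.2 = (0, 0) ∨ p.2 = (2, 0) ∨ p.2 = (2, 1)}

lemma isIndepDomSet_domSet (k : ℕ) : IsIndepDomSet (gFam k) (domSet k) := by
  constructor
  · rintro v hv
    have key : next v ∈ domSet k ∨ prev v ∈ domSet k ∨ cross v ∈ domSet k := by
      obtain ⟨i, r, j⟩ := v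
      revert hv
      rcases zmod_four_cases r with rfl | rfl | rfl | rfl <;> fin_cases j <;>
      simp [domSet, next, prev, cross, zmod_four_simps]
    rcases key with h | h | h
    · exact ⟨_, h, ((adj_iff _ _).2 (.inl rfl)).symm⟩
    · exact ⟨_, h, ((adj_iff _ _).2 (.inr (.inl rfl))).symm⟩
    · exact ⟨_, h, ((adj_iff _ _).2 (.inr (.inr rfl))).symm⟩
  · rintro ⟨i, r, j⟩ hu v hv huv
    rcases (adj_iff _ _).1 huv with rfl | rfl | rfl <;> revert hu hv <;>
    rcases zmod_four_cases r with rfl | rfl | rfl | rfl <;> fin_cases j <;>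
    simp [domSet, next, prev, cross, zmod_four_simps]

lemma ncard_domSet (k : ℕ) [NeZero k] : (domSet k).ncard = 3 * k := by
  rw [ncard_eq_sum]
  simp [Fin.sum_univ_two, sum_zmod_four, domSet, zmod_four_simps, mul_comm]

end gFam

/-- For every `k ≥ 1`, the graph `gFam k` is a connected cubic graph of order
`8k` with independent domination number `3k = (3/8)·8k`. -/
theorem stmt_4 (k : ℕ) (hk : 1 ≤ k) [NeZero k] :
    (gFam k).Connected ∧
    (∀ v, Nat.card ((gFam k).neighborSet v) = 3) ∧
    Fintype.card (ZMod k × ZMod 4 × Fin 2) = 8 * k ∧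
    indepDomNum (gFam k) = 3 * k := by
  refine ⟨gFam.connected, gFam.card_neighborSet, ?_, le_antisymm ?_ ?_⟩
  · simp only [Fintype.card_prod, ZMod.card, Fintype.card_fin]
    ring
  · exact Nat.sInf_le ⟨_, gFam.isIndepDomSet_domSet k, gFam.ncard_domSet k⟩
  · refine le_csInf ⟨_, _, gFam.isIndepDomSet_domSet k, rfl⟩ ?_
    rintro _ ⟨S, hS, rfl⟩
    exact gFam.le_ncard hS
end

section
/- For every integer ℓ ≥ 1, let H_ℓ be the graph obtained by taking a cycle C_{3ℓ} with vertex sequence a_1 b_1 c_1 … a_ℓ b_ℓ c_ℓ, and for each i ∈ {1,…,ℓ} adding five new vertices w_i, x_i, y_i, z_i^1, z_i^2, joining a_i to w_i, b_i to x_i, c_i to y_i, and, for each j ∈ {1,2}, joining z_i^j to each of w_i, x_i, y_i. Then H_ℓ is a connected cubic graph of order n = 8ℓ and i(H_ℓ) = 3ℓ = (3/8)n. -/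
open SimpleGraph

/-- The graph `hFam ℓ`: a cycle `C_{3ℓ}` with vertex sequence
`a₁ b₁ c₁ … a_ℓ b_ℓ c_ℓ` together with, for each `i`, five new vertices
`wᵢ, xᵢ, yᵢ, zᵢ¹, zᵢ²`, where `aᵢ–wᵢ`, `bᵢ–xᵢ`, `cᵢ–yᵢ` are edges and each
`zᵢʲ` is joined to `wᵢ, xᵢ, yᵢ`.  The vertex `(i, t)` encodes, for
`t = 0,…,7`, the vertices `aᵢ, bᵢ, cᵢ, wᵢ, xᵢ, yᵢ, zᵢ¹, zᵢ²` respectively. -/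
def hFam (l : ℕ) : SimpleGraph (ZMod l × Fin 8) :=
  SimpleGraph.fromRel (fun p q =>
    (q.1 = p.1 ∧
      ((p.2 = 0 ∧ q.2 = 1) ∨ (p.2 = 1 ∧ q.2 = 2) ∨           -- aᵢ–bᵢ, bᵢ–cᵢ
       (p.2 = 0 ∧ q.2 = 3) ∨ (p.2 = 1 ∧ q.2 = 4) ∨ (p.2 = 2 ∧ q.2 = 5) ∨
       (p.2 = 6 ∧ q.2 = 3) ∨ (p.2 = 6 ∧ q.2 = 4) ∨ (p.2 = 6 ∧ q.2 = 5) ∨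
       (p.2 = 7 ∧ q.2 = 3) ∨ (p.2 = 7 ∧ q.2 = 4) ∨ (p.2 = 7 ∧ q.2 = 5))) ∨
    (q.1 = p.1 + 1 ∧ p.2 = 2 ∧ q.2 = 0))                      -- cᵢ–aᵢ₊₁

/-- The neighbors of `(i, t)` in `hFam l`, as a set with one vertex per incident edge. -/
def hFamNbrs {l : ℕ} (i : ZMod l) : Fin 8 → Set (ZMod l × Fin 8)
  | 0 => {(i, 1), (i, 3), (i - 1, 2)}
  | 1 => {(i, 0), (i, 2), (i, 4)}
  | 2 => {(i, 1), (i, 5), (i + 1, 0)}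
  | 3 => {(i, 0), (i, 6), (i, 7)}
  | 4 => {(i, 1), (i, 6), (i, 7)}
  | 5 => {(i, 2), (i, 6), (i, 7)}
  | 6 => {(i, 3), (i, 4), (i, 5)}
  | 7 => {(i, 3), (i, 4), (i, 5)}

lemma hFam_neighborSet {l : ℕ} (i : ZMod l) (t : Fin 8) :
    (hFam l).neighborSet (i, t) = hFamNbrs i t := by
  ext ⟨j, s⟩
  simp only [mem_neighborSet, hFam, fromRel_adj]
  fin_cases t <;> fin_cases s <;> simp [hFamNbrs, eq_comm, eq_sub_iff_add_eq]

lemma hFam_adj_iff {l : ℕ} {i : ZMod l} {t : Fin 8} {v : ZMod l × Fin 8} :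
    (hFam l).Adj (i, t) v ↔ v ∈ hFamNbrs i t := by
  rw [← hFam_neighborSet, mem_neighborSet]

lemma hFam_card_neighborSet {l : ℕ} (v : ZMod l × Fin 8) :
    Nat.card ((hFam l).neighborSet v) = 3 := by
  obtain ⟨i, t⟩ := v
  rw [hFam_neighborSet, Nat.card_coe_set_eq, Set.ncard_eq_three]
  fin_cases t <;> exact ⟨_, _, _, by simp, by simp, by simp, rfl⟩

lemma hFam_connected (l : ℕ) [NeZero l] : (hFam l).Connected := by
  have step {i : ZMod l} {t : Fin 8} {v : ZMod l × Fin 8} (h : v ∈ hFamNbrs i t) :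
      (hFam l).Reachable (i, t) v := (hFam_adj_iff.2 h).reachable
  have block (i : ZMod l) (t : Fin 8) : (hFam l).Reachable (i, 0) (i, t) := by
    have h1 : (hFam l).Reachable (i, 0) (i, 1) := step (by simp [hFamNbrs])
    have h3 : (hFam l).Reachable (i, 0) (i, 3) := step (by simp [hFamNbrs])
    have h2 : (hFam l).Reachable (i, 0) (i, 2) := h1.trans (step (by simp [hFamNbrs]))
    have h6 : (hFam l).Reachable (i, 0) (i, 6) := h3.trans (step (by simp [hFamNbrs]))
    fin_cases t
    · exact .rfl
    · exact h1
    · exact h2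
    · exact h3
    · exact h1.trans (step (by simp [hFamNbrs]))
    · exact h2.trans (step (by simp [hFamNbrs]))
    · exact h6
    · exact h3.trans (step (by simp [hFamNbrs]))
  have base (n : ℕ) : (hFam l).Reachable (0, 0) ((n : ZMod l), 0) := by
    induction n with
    | zero => simp
    | succ n ih =>
      exact (ih.trans (block _ 2)).trans (step (by simp [hFamNbrs]))
  have root (v : ZMod l × Fin 8) : (hFam l).Reachable (0, 0) v := by
    obtain ⟨i, t⟩ := v
    obtain ⟨n, rfl⟩ := ZMod.natCast_zmod_surjective i
    exact (base n).trans (block _ t)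
  exact ⟨fun u v => (root u).symm.trans (root v)⟩

/-- The set of all vertices `bᵢ, zᵢ¹, zᵢ²`. -/
def hFamDomSet (l : ℕ) : Set (ZMod l × Fin 8) := Set.univ ×ˢ {1, 6, 7}

lemma isIndepDomSet_hFamDomSet (l : ℕ) : IsIndepDomSet (hFam l) (hFamDomSet l) := by
  constructor
  · rintro ⟨i, t⟩ h
    have dom {s : Fin 8} (hs : s ∈ ({1, 6, 7} : Set (Fin 8))) (h : (i, s) ∈ hFamNbrs i t) :
        ∃ u ∈ hFamDomSet l, (hFam l).Adj u (i, t) :=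
      ⟨(i, s), ⟨trivial, hs⟩, (hFam_adj_iff.2 h).symm⟩
    fin_cases t
    · exact dom (s := 1) (by simp) (by simp [hFamNbrs])
    · exact absurd h (by simp [hFamDomSet])
    · exact dom (s := 1) (by simp) (by simp [hFamNbrs])
    · exact dom (s := 6) (by simp) (by simp [hFamNbrs])
    · exact dom (s := 6) (by simp) (by simp [hFamNbrs])
    · exact dom (s := 6) (by simp) (by simp [hFamNbrs])
    · exact absurd h (by simp [hFamDomSet])
    · exact absurd h (by simp [hFamDomSet])
  · rintro ⟨i, t⟩ ⟨-, ht⟩ ⟨j, s⟩ ⟨-, hs⟩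
    rw [hFam_adj_iff]
    rcases ht with rfl | rfl | rfl <;> rcases hs with rfl | rfl | rfl <;> simp [hFamNbrs]

lemma ncard_hFamDomSet (l : ℕ) : (hFamDomSet l).ncard = 3 * l := by
  rw [hFamDomSet, Set.ncard_prod, Set.ncard_univ, Nat.card_zmod, mul_comm]
  congr 1
  exact Set.ncard_eq_three.2 ⟨_, _, _, by decide, by decide, by decide, rfl⟩

/-- An independent dominating set of `hFam l` has three vertices in every block. -/
lemma IsIndepDomSet.exists_three_in_block {l : ℕ} {S : Set (ZMod l × Fin 8)}
    (hS : IsIndepDomSet (hFam l) S) (i : ZMod l) :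
    ∃ f : Fin 3 → Fin 8, f.Injective ∧ ∀ k, (i, f k) ∈ S := by
  have three {p q r : Fin 8} (hp : (i, p) ∈ S) (hq : (i, q) ∈ S) (hr : (i, r) ∈ S)
      (hpq : p ≠ q) (hpr : p ≠ r) (hqr : q ≠ r) :
      ∃ f : Fin 3 → Fin 8, f.Injective ∧ ∀ k, (i, f k) ∈ S := by
    refine ⟨![p, q, r], ?_, fun k => by fin_cases k <;> assumption⟩
    intro a b
    fin_cases a <;> fin_cases b <;> simp [hpq, hpr, hqr, hpq.symm, hpr.symm, hqr.symm]
  have dom (t : Fin 8) : (i, t) ∈ S ∨ ∃ u ∈ S, u ∈ hFamNbrs i t := by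
    by_contra! h
    obtain ⟨u, hu, huv⟩ := hS.1 _ h.1
    exact h.2 u hu (hFam_adj_iff.1 huv.symm)
  have indep {t s : Fin 8} (ht : (i, t) ∈ S) (h : (i, s) ∈ hFamNbrs i t) : (i, s) ∉ S :=
    fun hs => hS.2 _ ht _ hs (hFam_adj_iff.2 h)
  have z_iff : (i, 6) ∈ S ↔ (i, 7) ∈ S := by
    have d6 := dom 6
    have d7 := dom 7
    have n6 (h : (i, 6) ∈ S) := And.intro (indep (s := 3) h (by simp [hFamNbrs]))
      (And.intro (indep (s := 4) h (by simp [hFamNbrs])) (indep (s := 5) h (by simp [hFamNbrs])))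
    have n7 (h : (i, 7) ∈ S) := And.intro (indep (s := 3) h (by simp [hFamNbrs]))
      (And.intro (indep (s := 4) h (by simp [hFamNbrs])) (indep (s := 5) h (by simp [hFamNbrs])))
    simp only [hFamNbrs, Set.mem_insert_iff, Set.mem_singleton_iff] at d6 d7
    grind
  by_cases h6 : (i, 6) ∈ S
  · have h7 := z_iff.1 h6
    have h4 : (i, 4) ∉ S := indep h6 (by simp [hFamNbrs])
    obtain h | ⟨u, hu, rfl | rfl | rfl⟩ := dom 1
    · exact three h6 h7 h (by decide) (by decide) (by decide)
    · exact three h6 h7 hu (by decide) (by decide) (by decide)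
    · exact three h6 h7 hu (by decide) (by decide) (by decide)
    · exact absurd hu h4
  · have h7 := mt z_iff.2 h6
    obtain ⟨p, hp, hpS⟩ : ∃ p : Fin 8, (p = 0 ∨ p = 3) ∧ (i, p) ∈ S := by
      obtain h | ⟨u, hu, rfl | rfl | rfl⟩ := dom 3
      exacts [⟨3, .inr rfl, h⟩, ⟨0, .inl rfl, hu⟩, absurd hu h6, absurd hu h7]
    obtain ⟨q, hq, hqS⟩ : ∃ p : Fin 8, (p = 1 ∨ p = 4) ∧ (i, p) ∈ S := by
      obtain h | ⟨u, hu, rfl | rfl | rfl⟩ := dom 4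
      exacts [⟨4, .inr rfl, h⟩, ⟨1, .inl rfl, hu⟩, absurd hu h6, absurd hu h7]
    obtain ⟨r, hr, hrS⟩ : ∃ p : Fin 8, (p = 2 ∨ p = 5) ∧ (i, p) ∈ S := by
      obtain h | ⟨u, hu, rfl | rfl | rfl⟩ := dom 5
      exacts [⟨5, .inr rfl, h⟩, ⟨2, .inl rfl, hu⟩, absurd hu h6, absurd hu h7]
    refine three hpS hqS hrS ?_ ?_ ?_ <;> grind

lemma IsIndepDomSet.three_mul_le_ncard {l : ℕ} [NeZero l] {S : Set (ZMod l × Fin 8)}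
    (hS : IsIndepDomSet (hFam l) S) : 3 * l ≤ S.ncard := by
  choose f hf hfS using hS.exists_three_in_block
  let g : ZMod l × Fin 3 → S := fun p => ⟨(p.1, f p.1 p.2), hfS _ _⟩
  have hg : g.Injective := by
    rintro ⟨i, a⟩ ⟨j, b⟩ h
    obtain ⟨hij, hab⟩ : i = j ∧ f i a = f j b := by simpa [g] using h
    subst hij
    rw [hf i hab]
  simpa [Nat.card_prod, mul_comm] using Nat.card_le_card_of_injective g hg

/-- For every `ℓ ≥ 1`, the graph `hFam ℓ` is a connected cubic graph of order
`8ℓ` with independent domination number `3ℓ = (3/8)·8ℓ`. -/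
theorem stmt_5 (l : ℕ) (hl : 1 ≤ l) [NeZero l] :
    (hFam l).Connected ∧
    (∀ v, Nat.card ((hFam l).neighborSet v) = 3) ∧
    Fintype.card (ZMod l × Fin 8) = 8 * l ∧
    indepDomNum (hFam l) = 3 * l := by
  refine ⟨hFam_connected l, hFam_card_neighborSet, by simp [mul_comm], ?_⟩
  refine le_antisymm
    (Nat.sInf_le ⟨hFamDomSet l, isIndepDomSet_hFamDomSet l, ncard_hFamDomSet l⟩) ?_
  refine le_csInf ⟨_, hFamDomSet l, isIndepDomSet_hFamDomSet l, rfl⟩ ?_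
  rintro _ ⟨S, hS, rfl⟩
  exact hS.three_mul_le_ncard
end

section
/- If G is a subcubic graph of order n with no isolated vertex, then i(G) ≤ n/2. -/
open SimpleGraph

theorem indepDomNum_le_card {V : Type*} {G : SimpleGraph V} {D : Finset V}
    (hD : IsIndepDomSet G (D : Set V)) : indepDomNum G ≤ D.card :=
  Nat.sInf_le ⟨D, hD, Set.ncard_coe_finset D⟩

/-- Four pairwise distinct neighbours are too many for a vertex of degree at most three. -/
theorem not_four_neighbors {V : Type*} [Finite V] {G : SimpleGraph V} {v a b c d : V}
    (hv : Nat.card (G.neighborSet v) ≤ 3)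
    (ha : G.Adj v a) (hb : G.Adj v b) (hc : G.Adj v c) (hd : G.Adj v d)
    (hab : a ≠ b) (hac : a ≠ c) (had : a ≠ d) (hbc : b ≠ c) (hbd : b ≠ d) (hcd : c ≠ d) :
    False := by
  classical
  have hsub : (({a, b, c, d} : Finset V) : Set V) ⊆ G.neighborSet v := by
    intro x hx
    simp only [Finset.coe_insert, Finset.coe_singleton, Set.mem_insert_iff,
      Set.mem_singleton_iff] at hx
    rcases hx with rfl | rfl | rfl | rfl <;> assumption
  have hle := Set.ncard_le_ncard hsub (Set.toFinite _)
  have hcard : ({a, b, c, d} : Finset V).card = 4 := by simp [*]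
  rw [Set.ncard_coe_finset, hcard, ← Nat.card_coe_set_eq] at hle
  omega

/-- A pair of disjoint independent sets contained in `B`. -/
def IsIndepPair {V : Type*} (G : SimpleGraph V) (B I J : Finset V) : Prop :=
  I ⊆ B ∧ J ⊆ B ∧ Disjoint I J ∧ (∀ u ∈ I, ∀ v ∈ I, ¬ G.Adj u v) ∧
    ∀ u ∈ J, ∀ v ∈ J, ¬ G.Adj u v

theorem IsIndepPair.symm {V : Type*} {G : SimpleGraph V} {B I J : Finset V}
    (h : IsIndepPair G B I J) : IsIndepPair G B J I :=
  ⟨h.2.1, h.1, h.2.2.1.symm, h.2.2.2.2, h.2.2.2.1⟩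

/-- Both members of an independent pair of maximum total size dominate the vertices of `B` that
lie in neither of them. -/
theorem IsIndepPair.exists_adj_of_notMem {V : Type*} {G : SimpleGraph V} {B I J : Finset V}
    (h : IsIndepPair G B I J)
    (hmax : ∀ I' J', IsIndepPair G B I' J' → I'.card + J'.card ≤ I.card + J.card)
    {r : V} (hr : r ∈ B) (hrI : r ∉ I) (hrJ : r ∉ J) : ∃ u ∈ I, G.Adj u r := by
  classical
  by_contra! hno
  obtain ⟨hIB, hJB, hdis, hI, hJ⟩ := h
  have key := hmax (insert r I) J ⟨Finset.insert_subset hr hIB, hJB,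
    Finset.disjoint_insert_left.2 ⟨hrJ, hdis⟩, by
      intro u hu v hv
      rcases Finset.mem_insert.1 hu with rfl | hu₁ <;> rcases Finset.mem_insert.1 hv with rfl | hv₁
      · exact G.loopless.irrefl _
      · exact fun e => hno v hv₁ e.symm
      · exact hno u hu₁
      · exact hI u hu₁ v hv₁, hJ⟩
  rw [Finset.card_insert_of_notMem hrI] at key
  omega

/-- The first member of an independent pair of maximum total size in a subcubic graph dominates
the second one, if every vertex of `B` has a neighbour inside and a neighbour outside `B`. -/
theorem IsIndepPair.exists_adj_of_mem_right {V : Type*} [Finite V] {G : SimpleGraph V}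
    {B I J : Finset V}
    (hsub : ∀ v : V, Nat.card (G.neighborSet v) ≤ 3)
    (hin : ∀ v ∈ B, ∃ u ∈ B, G.Adj v u) (hout : ∀ v ∈ B, ∃ u ∉ B, G.Adj v u)
    (h : IsIndepPair G B I J)
    (hmax : ∀ I' J', IsIndepPair G B I' J' → I'.card + J'.card ≤ I.card + J.card)
    {j : V} (hj : j ∈ J) : ∃ u ∈ I, G.Adj u j := by
  classical
  by_contra! hno
  have ⟨hIB, hJB, hdis, hI, hJ⟩ := h
  obtain ⟨r, hrB, hjr⟩ := hin j (hJB hj)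
  have hrI : r ∉ I := fun hr => hno r hr hjr.symm
  have hrJ : r ∉ J := fun hr => hJ j hj r hr hjr
  obtain ⟨i, hi, hir⟩ := h.exists_adj_of_notMem hmax hrB hrI hrJ
  obtain ⟨a, haB, hra⟩ := hout r hrB
  have hjI : j ∉ I := fun hjI => Finset.disjoint_left.1 hdis hjI hj
  have huniq : ∀ v ∈ J, G.Adj r v → v = j := by
    intro v hv hrv
    by_contra hvj
    exact not_four_neighbors (hsub r) hra hir.symm hjr.symm hrv
      (fun e => haB (e ▸ hIB hi)) (fun e => haB (e ▸ hJB hj)) (fun e => haB (e ▸ hJB hv))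
      (fun e => hjI (e ▸ hi)) (fun e => Finset.disjoint_left.1 hdis hi (e ▸ hv))
      (Ne.symm hvj)
  have key := hmax (insert j I) (insert r (J.erase j)) ⟨Finset.insert_subset (hJB hj) hIB,
    Finset.insert_subset hrB ((Finset.erase_subset _ _).trans hJB), by
      rw [Finset.disjoint_left]
      intro x hx hx'
      rcases Finset.mem_insert.1 hx with rfl | hx <;>
        rcases Finset.mem_insert.1 hx' with rfl | hx'
      · exact hrJ hj
      · simp at hx'
      · exact hrI hx
      · exact Finset.disjoint_left.1 hdis hx (Finset.mem_of_mem_erase hx'), by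
      intro u hu v hv
      rcases Finset.mem_insert.1 hu with rfl | hu₁ <;> rcases Finset.mem_insert.1 hv with rfl | hv₁
      · exact G.loopless.irrefl _
      · exact fun e => hno v hv₁ e.symm
      · exact hno u hu₁
      · exact hI u hu₁ v hv₁, by
      intro u hu v hv huv
      rcases Finset.mem_insert.1 hu with rfl | hu₁ <;> rcases Finset.mem_insert.1 hv with rfl | hv₁
      · exact G.loopless.irrefl _ huv
      · exact Finset.ne_of_mem_erase hv₁ (huniq v (Finset.mem_of_mem_erase hv₁) huv)
      · exact Finset.ne_of_mem_erase hu₁ (huniq u (Finset.mem_of_mem_erase hu₁) huv.symm)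
      · exact hJ u (Finset.mem_of_mem_erase hu₁) v (Finset.mem_of_mem_erase hv₁) huv⟩
  rw [Finset.card_insert_of_notMem hjI,
    Finset.card_insert_of_notMem (fun hr => hrJ (Finset.mem_of_mem_erase hr)),
    Finset.card_erase_of_mem hj] at key
  have := Finset.card_pos.2 ⟨j, hj⟩
  omega

/-- If `G` is a subcubic graph of order `n` with no isolated vertex, then
`i(G) ≤ n/2`. -/
theorem stmt_6 {V : Type*} [Fintype V] (G : SimpleGraph V)
    (hsub : ∀ v : V, Nat.card (G.neighborSet v) ≤ 3)
    (hiso : ∀ v : V, ∃ u, G.Adj v u) :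
    2 * indepDomNum G ≤ Fintype.card V := by
  classical
  -- A maximum independent set `A`.
  obtain ⟨A, hA, hAmax⟩ := Finset.exists_max_image
    (Finset.univ.filter fun A : Finset V => ∀ u ∈ A, ∀ v ∈ A, ¬ G.Adj u v) Finset.card
    ⟨∅, by simp⟩
  simp only [Finset.mem_filter, Finset.mem_univ, true_and] at hA hAmax
  have hAdom : ∀ v ∉ A, ∃ u ∈ A, G.Adj v u := by
    intro v hv
    by_contra! hno
    have key := hAmax (insert v A) (by
      intro x hx y hy
      rcases Finset.mem_insert.1 hx with rfl | hx₁ <;> rcases Finset.mem_insert.1 hy with rfl | hy₁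
      · exact G.loopless.irrefl _
      · exact hno y hy₁
      · exact fun e => hno x hx₁ e.symm
      · exact hA x hx₁ y hy₁)
    rw [Finset.card_insert_of_notMem hv] at key
    omega
  -- `Z` consists of the vertices outside `A` with all neighbours in `A`, and `N` of the
  -- neighbours of `Z`.
  set Z : Finset V := Finset.univ.filter fun v => v ∉ A ∧ ∀ u, G.Adj v u → u ∈ A with hZ
  set N : Finset V := A.filter fun a => ∃ z ∈ Z, G.Adj z a with hN
  have memZ : ∀ v, v ∈ Z ↔ v ∉ A ∧ ∀ u, G.Adj v u → u ∈ A := by simp [hZ]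
  have memN : ∀ v, v ∈ N ↔ v ∈ A ∧ ∃ z ∈ Z, G.Adj z v := by simp [hN]
  have hNA : N ⊆ A := Finset.filter_subset _ _
  have hZA : Disjoint A Z := Finset.disjoint_left.2 fun x hx hx' => ((memZ x).1 hx').1 hx
  have hZN : Z.card ≤ N.card := by
    have key := hAmax ((A \ N) ∪ Z) (by
      intro x hx y hy hxy
      simp only [Finset.mem_union, Finset.mem_sdiff] at hx hy
      rcases hx with hx | hx <;> rcases hy with hy | hy
      · exact hA x hx.1 y hy.1 hxy
      · exact hx.2 ((memN x).2 ⟨hx.1, y, hy, hxy.symm⟩)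
      · exact hy.2 ((memN y).2 ⟨hy.1, x, hx, hxy⟩)
      · exact ((memZ y).1 hy).1 (((memZ x).1 hx).2 y hxy))
    rw [Finset.card_union_of_disjoint (hZA.mono_left Finset.sdiff_subset),
      Finset.card_sdiff_of_subset hNA] at key
    have := Finset.card_le_card hNA
    omega
  set B : Finset V := Finset.univ \ (A ∪ Z) with hB
  have memB : ∀ v, v ∈ B ↔ v ∉ A ∧ v ∉ Z := by simp [hB]
  have hin : ∀ v ∈ B, ∃ u ∈ B, G.Adj v u := by
    intro v hv
    obtain ⟨hvA, hvZ⟩ := (memB v).1 hv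
    have : ∃ u, G.Adj v u ∧ u ∉ A := by
      by_contra! hno
      exact hvZ ((memZ v).2 ⟨hvA, hno⟩)
    obtain ⟨u, hvu, huA⟩ := this
    exact ⟨u, (memB u).2 ⟨huA, fun hu => hvA (((memZ u).1 hu).2 v hvu.symm)⟩, hvu⟩
  have hout : ∀ v ∈ B, ∃ u ∉ B, G.Adj v u := by
    intro v hv
    obtain ⟨u, hu, hvu⟩ := hAdom v ((memB v).1 hv).1
    exact ⟨u, fun h => ((memB u).1 h).1 hu, hvu⟩
  -- An independent pair in `B` of maximum total size.
  obtain ⟨⟨I, J⟩, hIJ, hmax⟩ := Finset.exists_max_image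
    (Finset.univ.filter fun p : Finset V × Finset V => IsIndepPair G B p.1 p.2)
    (fun p => p.1.card + p.2.card) ⟨(∅, ∅), by
      rw [Finset.mem_filter]; simp [IsIndepPair]⟩
  simp only [Finset.mem_filter, Finset.mem_univ, true_and, Prod.forall] at hIJ hmax
  have hmax' : ∀ I' J', IsIndepPair G B I' J' → I'.card + J'.card ≤ J.card + I.card :=
    fun I' J' h => (hmax I' J' h).trans_eq (add_comm _ _)
  let C : Finset V → Finset V := fun K => (A \ N).filter fun a => ∀ u ∈ K, ¬ G.Adj u a
  have memC : ∀ K v, v ∈ C K ↔ (v ∈ A ∧ v ∉ N) ∧ ∀ u ∈ K, ¬ G.Adj u v := by simp [C]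
  have bound : ∀ K ⊆ B, (∀ u ∈ K, ∀ v ∈ K, ¬ G.Adj u v) →
      (∀ v ∈ B, v ∉ K → ∃ u ∈ K, G.Adj u v) →
      indepDomNum G ≤ Z.card + K.card + (C K).card := by
    intro K hKB hK hdom
    refine (indepDomNum_le_card (D := Z ∪ K ∪ C K) ⟨?_, ?_⟩).trans
      ((Finset.card_union_le _ _).trans (Nat.add_le_add_right (Finset.card_union_le _ _) _))
    · intro v hv
      simp only [Finset.mem_coe, Finset.mem_union, not_or] at hv ⊢
      obtain ⟨⟨hvZ, hvK⟩, hvC⟩ := hv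
      by_cases hvA : v ∈ A
      · by_cases hvN : v ∈ N
        · obtain ⟨-, z, hz, hzv⟩ := (memN v).1 hvN
          exact ⟨z, Or.inl (Or.inl hz), hzv⟩
        · have : ∃ u ∈ K, G.Adj u v := by
            by_contra! hno
            exact hvC ((memC K v).2 ⟨⟨hvA, hvN⟩, hno⟩)
          obtain ⟨u, hu, huv⟩ := this
          exact ⟨u, Or.inl (Or.inr hu), huv⟩
      · obtain ⟨u, hu, huv⟩ := hdom v ((memB v).2 ⟨hvA, hvZ⟩) hvK
        exact ⟨u, Or.inl (Or.inr hu), huv⟩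
    · have hZK : ∀ u ∈ Z, ∀ v ∈ Z ∪ K ∪ C K, ¬ G.Adj u v := by
        intro u hu v hv huv
        have hvA := ((memZ u).1 hu).2 v huv
        simp only [Finset.mem_union] at hv
        rcases hv with (hv | hv) | hv
        · exact ((memZ v).1 hv).1 hvA
        · exact ((memB v).1 (hKB hv)).1 hvA
        · exact ((memC K v).1 hv).1.2 ((memN v).2 ⟨hvA, u, hu, huv⟩)
      intro u hu v hv huv
      rw [Finset.mem_coe] at hu hv
      have hu' := hu
      have hv' := hv
      simp only [Finset.mem_union] at hu hv
      rcases hu with (hu | hu) | hu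
      · exact hZK u hu v hv' huv
      · rcases hv with (hv | hv) | hv
        · exact hZK v hv u hu' huv.symm
        · exact hK u hu v hv huv
        · exact ((memC K v).1 hv).2 u hu huv
      · rcases hv with (hv | hv) | hv
        · exact hZK v hv u hu' huv.symm
        · exact ((memC K u).1 hu).2 v hv huv.symm
        · exact hA u ((memC K u).1 hu).1.1 v ((memC K v).1 hv).1.1 huv
  have ⟨hIB, hJB, hdis, hI, hJ⟩ := hIJ
  have boundI := bound I hIB hI fun v hv hvI => by
    by_cases hvJ : v ∈ J
    · exact hIJ.exists_adj_of_mem_right hsub hin hout hmax hvJ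
    · exact hIJ.exists_adj_of_notMem hmax hv hvI hvJ
  have boundJ := bound J hJB hJ fun v hv hvJ => by
    by_cases hvI : v ∈ I
    · exact hIJ.symm.exists_adj_of_mem_right hsub hin hout hmax' hvI
    · exact hIJ.symm.exists_adj_of_notMem hmax' hv hvJ hvI
  -- Vertices of `A \ N` adjacent to neither `I` nor `J` inject into the rest of `B`.
  have hR : (C I ∩ C J).card ≤ (B \ (I ∪ J)).card := by
    have hex : ∀ a ∈ C I ∩ C J, ∃ r ∈ B \ (I ∪ J), G.Adj r a := by
      intro a ha
      obtain ⟨haI, haJ⟩ := Finset.mem_inter.1 ha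
      obtain ⟨⟨haA, haN⟩, hnI⟩ := (memC I a).1 haI
      have hnJ := ((memC J a).1 haJ).2
      obtain ⟨r, har⟩ := hiso a
      refine ⟨r, ?_, har.symm⟩
      simp only [Finset.mem_sdiff, Finset.mem_union, not_or]
      exact ⟨(memB r).2 ⟨fun hr => hA a haA r hr har,
        fun hr => haN ((memN a).2 ⟨haA, r, hr, har.symm⟩)⟩,
        fun hr => hnI r hr har.symm, fun hr => hnJ r hr har.symm⟩
    choose! f hf hfa using hex
    refine Finset.card_le_card_of_injOn f hf ?_
    intro a ha b hb hab
    by_contra hne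
    rw [Finset.mem_coe] at ha hb
    have hr := hf a ha
    simp only [Finset.mem_sdiff, Finset.mem_union, not_or] at hr
    obtain ⟨i, hi, hir⟩ := hIJ.exists_adj_of_notMem hmax hr.1 hr.2.1 hr.2.2
    obtain ⟨j, hj, hjr⟩ := hIJ.symm.exists_adj_of_notMem hmax' hr.1 hr.2.2 hr.2.1
    have haA := ((memC I a).1 (Finset.mem_inter.1 ha).1).1.1
    have hbA := ((memC I b).1 (Finset.mem_inter.1 hb).1).1.1
    have hiA := ((memB i).1 (hIB hi)).1
    have hjA := ((memB j).1 (hJB hj)).1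
    exact not_four_neighbors (hsub (f a)) (hfa a ha) (hab ▸ hfa b hb) hir.symm hjr.symm hne
      (fun e => hiA (e ▸ haA)) (fun e => hjA (e ▸ haA)) (fun e => hiA (e ▸ hbA))
      (fun e => hjA (e ▸ hbA)) (fun e => Finset.disjoint_left.1 hdis hi (e ▸ hj))
  have hunion : (C I ∪ C J).card ≤ (A \ N).card :=
    Finset.card_le_card (Finset.union_subset (Finset.filter_subset _ _) (Finset.filter_subset _ _))
  have hsum := Finset.card_union_add_card_inter (C I) (C J)
  have hcardA := Finset.card_sdiff_add_card_eq_card hNA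
  have hcardB := Finset.card_sdiff_add_card_eq_card (Finset.union_subset hIB hJB)
  rw [Finset.card_union_of_disjoint hdis] at hcardB
  have hcardV := Finset.card_sdiff_add_card_eq_card (Finset.subset_univ (A ∪ Z))
  rw [Finset.card_union_of_disjoint hZA, ← hB, Finset.card_univ] at hcardV
  omega
end
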